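/- arXiv:1603.04050 — 8 statements merged into one kernel-verified Lean document; each statement's English description precedes it below -/
import Mathlib

section
/- Let κ ∈ ℝ, t₀ < t_max, and let r : [t₀, t_max) → ℝ be a smooth function with r(t) ≥ κ for all t ∈ [t₀, t_max). Let s : [t₀, t_max) → ℝ be a differentiable function satisfying s'(t) + s(t)² + r(t) = 0 for all t ∈ [t₀, t_max), and let λ̃ : [t₀, t_max) → ℝ be a solution of the scalar Riccati equation with parameter κ. If s(t₀) ≤ λ̃(t₀), then s(t) ≤ λ̃(t) for all t ∈ [t₀, t_max). -/
/-- **Scalar Riccati comparison** (Eschenburg–Heintze).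
If `s' + s² + r = 0` with `r ≥ κ`, `λ̃' + λ̃² + κ = 0`, and `s t₀ ≤ λ̃ t₀`,
then `s ≤ λ̃` on `[t₀, t_max)`. -/
theorem scalar_riccati_comparison
    (κ t₀ tmax : ℝ) (ht : t₀ < tmax)
    (r s lam : ℝ → ℝ)
    (hr_smooth : ContDiffOn ℝ (⊤ : ℕ∞) r (Set.Ico t₀ tmax))
    (hr_ge : ∀ t ∈ Set.Ico t₀ tmax, κ ≤ r t)
    (hs : ∀ t ∈ Set.Ico t₀ tmax, HasDerivAt s (-(s t ^ 2) - r t) t)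
    (hlam : ∀ t ∈ Set.Ico t₀ tmax, HasDerivAt lam (-(lam t ^ 2) - κ) t)
    (h0 : s t₀ ≤ lam t₀) :
    ∀ t ∈ Set.Ico t₀ tmax, s t ≤ lam t := by
  intro t htI
  have hmem : ∀ x ∈ Set.Icc t₀ t, x ∈ Set.Ico t₀ tmax :=
    fun x hx => ⟨hx.1, hx.2.trans_lt htI.2⟩
  have hcs : ContinuousOn s (Set.Icc t₀ t) :=
    fun x hx => (hs x (hmem x hx)).continuousAt.continuousWithinAt
  have hcl : ContinuousOn lam (Set.Icc t₀ t) :=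
    fun x hx => (hlam x (hmem x hx)).continuousAt.continuousWithinAt
  obtain ⟨M, hM⟩ := isCompact_Icc.exists_bound_of_continuousOn (hcs.add hcl)
  have key : ∀ ε > 0, s t - lam t ≤ ε * Real.exp ((M + 1) * (t - t₀)) := by
    intro ε hε
    have hB : ∀ x, HasDerivAt (fun x => ε * Real.exp ((M + 1) * (x - t₀)))
        (ε * (Real.exp ((M + 1) * (x - t₀)) * ((M + 1) * 1))) x := fun x =>
      ((((hasDerivAt_id x).sub_const t₀).const_mul (M + 1)).exp).const_mul ε
    refine image_le_of_deriv_right_lt_deriv_boundary (hcs.sub hcl)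
      (fun x hx => ((hs x (hmem x ⟨hx.1, hx.2.le⟩)).sub
        (hlam x (hmem x ⟨hx.1, hx.2.le⟩))).hasDerivWithinAt) ?_ hB ?_ ⟨htI.1, le_rfl⟩
    · simp only [Pi.sub_apply, sub_self, mul_zero, Real.exp_zero, mul_one]
      linarith
    · intro x hx heq
      have hx' : x ∈ Set.Icc t₀ t := ⟨hx.1, hx.2.le⟩
      have hlow : -M ≤ s x + lam x := (abs_le.mp (hM x hx')).1
      have hr := hr_ge x (hmem x hx')
      have hpos : 0 < ε * Real.exp ((M + 1) * (x - t₀)) := by positivity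
      rw [Pi.sub_apply] at heq
      have hd : 0 < s x - lam x := heq ▸ hpos
      calc _ ≤ -(s x + lam x) * (s x - lam x) := by linarith
        _ < (M + 1) * (s x - lam x) := mul_lt_mul_of_pos_right (by linarith) hd
        _ = _ := by rw [heq]; ring
  have hlim : s t - lam t ≤ 0 := by
    refine le_of_forall_pos_le_add fun δ hδ => ?_
    have h := key (δ / Real.exp ((M + 1) * (t - t₀))) (by positivity)
    rwa [div_mul_cancel₀ _ (Real.exp_pos _).ne', ← zero_add δ] at h
  linarith
end

section
/- Let κ ∈ ℝ, t₀ < t_max, and let r : [t₀, t_max) → ℝ be a smooth function with r(t) ≥ κ for all t ∈ [t₀, t_max). Let s : [t₀, t_max) → ℝ be a differentiable function satisfying s'(t) + s(t)² + r(t) = 0 for all t ∈ [t₀, t_max), and let λ̃ : [t₀, t_max) → ℝ be a solution of the scalar Riccati equation with parameter κ, with s(t₀) ≤ λ̃(t₀). If s(t₁) = λ̃(t₁) for some t₁ ∈ (t₀, t_max), then s(t) = λ̃(t) for all t ∈ [t₀, t₁] and r(t) = κ for all t ∈ [t₀, t₁]. -/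
/-- A continuous function on a compact interval has an antiderivative there which is the
restriction of a differentiable function on the line. -/
theorem ContinuousOn.exists_hasDerivAt_Icc {p : ℝ → ℝ} {a b : ℝ} (hab : a ≤ b)
    (hp : ContinuousOn p (Set.Icc a b)) :
    ∃ P : ℝ → ℝ, ∀ t ∈ Set.Icc a b, HasDerivAt P (p t) t := by
  have hc : Continuous (Set.IccExtend hab ((Set.Icc a b).domRestrict p)) :=
    (continuousOn_iff_continuous_domRestrict.mp hp).Icc_extend'
  refine ⟨fun t => ∫ x in a..t, Set.IccExtend hab ((Set.Icc a b).domRestrict p) x, fun t ht => ?_⟩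
  have h := (hc.integral_hasStrictDerivAt a t).hasDerivAt
  rwa [Set.IccExtend_of_mem hab _ ht] at h

/-- If `u' + p u ≥ 0` on `[a, b]`, `u a ≥ 0` and `u b = 0`, then `u` vanishes on `[a, b]`. -/
theorem eq_zero_of_linear_differential_inequality {u u' p : ℝ → ℝ} {a b : ℝ} (hab : a ≤ b)
    (hp : ContinuousOn p (Set.Icc a b))
    (hu : ∀ t ∈ Set.Icc a b, HasDerivAt u (u' t) t)
    (hge : ∀ t ∈ Set.Icc a b, 0 ≤ u' t + p t * u t)
    (ha : 0 ≤ u a) (hb : u b = 0) :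
    ∀ t ∈ Set.Icc a b, u t = 0 := by
  obtain ⟨P, hP⟩ := hp.exists_hasDerivAt_Icc hab
  have hv : ∀ t ∈ Set.Icc a b, HasDerivAt (fun t => u t * Real.exp (P t))
      ((u' t + p t * u t) * Real.exp (P t)) t := fun t ht =>
    ((hu t ht).mul (hP t ht).exp).congr_deriv (by ring)
  have hmono : MonotoneOn (fun t => u t * Real.exp (P t)) (Set.Icc a b) :=
    monotoneOn_of_hasDerivWithinAt_nonneg (convex_Icc a b)
      (fun t ht => (hv t ht).continuousAt.continuousWithinAt)
      (fun t ht => (hv t (interior_subset ht)).hasDerivWithinAt)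
      (fun t ht => mul_nonneg (hge t (interior_subset ht)) (Real.exp_pos _).le)
  intro t ht
  have h1 : u a * Real.exp (P a) ≤ u t * Real.exp (P t) :=
    hmono (Set.left_mem_Icc.mpr hab) ht ht.1
  have h2 : u t * Real.exp (P t) ≤ u b * Real.exp (P b) :=
    hmono ht (Set.right_mem_Icc.mpr hab) ht.2
  rw [hb, zero_mul] at h2
  have h3 : u t * Real.exp (P t) = 0 :=
    le_antisymm h2 ((mul_nonneg ha (Real.exp_pos _).le).trans h1)
  exact (mul_eq_zero.mp h3).resolve_right (Real.exp_ne_zero _)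

/-- **Rigidity in the scalar Riccati comparison** (Eschenburg–Heintze).
If `s' + s² + r = 0` with `r ≥ κ`, `λ̃' + λ̃² + κ = 0`, `s t₀ ≤ λ̃ t₀`, and
`s t₁ = λ̃ t₁` for some `t₁ ∈ (t₀, t_max)`, then `s = λ̃` and `r = κ` on `[t₀, t₁]`. -/
theorem scalar_riccati_comparison_rigidity
    (κ t₀ tmax : ℝ) (ht : t₀ < tmax)
    (r s lam : ℝ → ℝ)
    (hr_smooth : ContDiffOn ℝ (⊤ : ℕ∞) r (Set.Ico t₀ tmax))
    (hr_ge : ∀ t ∈ Set.Ico t₀ tmax, κ ≤ r t)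
    (hs : ∀ t ∈ Set.Ico t₀ tmax, HasDerivAt s (-(s t ^ 2) - r t) t)
    (hlam : ∀ t ∈ Set.Ico t₀ tmax, HasDerivAt lam (-(lam t ^ 2) - κ) t)
    (h0 : s t₀ ≤ lam t₀)
    (t₁ : ℝ) (ht₁ : t₁ ∈ Set.Ioo t₀ tmax) (heq : s t₁ = lam t₁) :
    ∀ t ∈ Set.Icc t₀ t₁, s t = lam t ∧ r t = κ := by
  have hmem : ∀ t ∈ Set.Icc t₀ t₁, t ∈ Set.Ico t₀ tmax :=
    fun t h => ⟨h.1, h.2.trans_lt ht₁.2⟩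
  have hzero := eq_zero_of_linear_differential_inequality
    (u := fun t => lam t - s t) (p := fun t => lam t + s t) ht₁.1.le
    (fun t h => ((hlam t (hmem t h)).continuousAt.add
      (hs t (hmem t h)).continuousAt).continuousWithinAt)
    (fun t h => (hlam t (hmem t h)).sub (hs t (hmem t h)))
    (fun t h => by linarith [hr_ge t (hmem t h)])
    (sub_nonneg.mpr h0) (sub_eq_zero.mpr heq.symm)
  have hsl : ∀ t ∈ Set.Icc t₀ t₁, s t = lam t := fun t h => (sub_eq_zero.mp (hzero t h)).symm
  intro t h
  refine ⟨hsl t h, ?_⟩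
  have hd : HasDerivWithinAt s (-(lam t ^ 2) - κ) (Set.Icc t₀ t₁) t :=
    (hlam t (hmem t h)).hasDerivWithinAt.congr hsl (hsl t h)
  have := (uniqueDiffOn_Icc ht₁.1 t h).eq_deriv _ (hs t (hmem t h)).hasDerivWithinAt hd
  rw [hsl t h] at this
  linarith
end

section
/- Let V be a k-dimensional real inner product space, κ ∈ ℝ, and t₀ < t_max. Let Ŝ, R̂ : [t₀, t_max) → End(V) be smooth families of self-adjoint endomorphisms satisfying Ŝ'(t) + Ŝ(t)² + R̂(t) = 0 for all t ∈ [t₀, t_max). Let λ̃ : [t₀, t_max) → ℝ be a solution of the scalar Riccati equation with parameter κ. If trace Ŝ(t₀) ≤ k·λ̃(t₀) and trace R̂(t) ≥ k·κ for all t ∈ [t₀, t_max), then trace Ŝ(t) ≤ k·λ̃(t) for all t ∈ [t₀, t_max). -/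
open RealInnerProductSpace

/-- The trace of the square of a symmetric endomorphism is nonnegative. -/
lemma LinearMap.IsSymmetric.trace_comp_self_nonneg
    {V : Type*} [NormedAddCommGroup V] [InnerProductSpace ℝ V] [FiniteDimensional ℝ V]
    {A : V →ₗ[ℝ] V} (hA : A.IsSymmetric) : 0 ≤ LinearMap.trace ℝ V (A ∘ₗ A) := by
  rw [LinearMap.trace_eq_sum_inner _ (stdOrthonormalBasis ℝ V)]
  refine Finset.sum_nonneg fun i _ => ?_
  rw [LinearMap.comp_apply, ← hA]
  exact real_inner_self_nonneg

/-- Completing the square in the trace of the square of a symmetric endomorphism. -/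
lemma LinearMap.IsSymmetric.two_mul_trace_le_trace_comp_self_add
    {V : Type*} [NormedAddCommGroup V] [InnerProductSpace ℝ V] [FiniteDimensional ℝ V]
    {A : V →ₗ[ℝ] V} (hA : A.IsSymmetric) (c : ℝ) :
    2 * c * LinearMap.trace ℝ V A ≤
      LinearMap.trace ℝ V (A ∘ₗ A) + Module.finrank ℝ V * c ^ 2 := by
  have hsym : (A - c • LinearMap.id).IsSymmetric := fun x y => by
    simp [inner_sub_left, inner_sub_right, inner_smul_left, inner_smul_right, hA x y]
  have hexp : (A - c • LinearMap.id) ∘ₗ (A - c • LinearMap.id) =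
      A ∘ₗ A - (2 * c) • A + c ^ 2 • LinearMap.id := by
    ext x
    simp only [LinearMap.comp_apply, LinearMap.sub_apply, LinearMap.add_apply,
      LinearMap.smul_apply, LinearMap.id_apply, map_sub, map_smul]
    module
  have h := hsym.trace_comp_self_nonneg
  rw [hexp] at h
  simp only [map_add, map_sub, map_smul, LinearMap.trace_id, smul_eq_mul] at h
  linarith

/-- The trace commutes with differentiation. -/
lemma HasDerivAt.linearMap_trace
    {V : Type*} [NormedAddCommGroup V] [NormedSpace ℝ V] [FiniteDimensional ℝ V]
    {S : ℝ → V →L[ℝ] V} {S' : V →L[ℝ] V} {t : ℝ} (h : HasDerivAt S S' t) :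
    HasDerivAt (fun s => LinearMap.trace ℝ V (S s : V →ₗ[ℝ] V))
      (LinearMap.trace ℝ V (S' : V →ₗ[ℝ] V)) t :=
  (LinearMap.toContinuousLinearMap
    (LinearMap.trace ℝ V ∘ₗ ContinuousLinearMap.coeLM ℝ)).hasFDerivAt.comp_hasDerivAt t h

/-- A differential inequality `f' ≤ c f` preserves nonpositivity of `f`. -/
lemma nonpos_of_hasDerivAt_le_mul {f f' c : ℝ → ℝ} {a b : ℝ} (hab : a ≤ b)
    (hf : ∀ x ∈ Set.Icc a b, HasDerivAt f (f' x) x) (hc : ContinuousOn c (Set.Icc a b))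
    (hle : ∀ x ∈ Set.Icc a b, f' x ≤ c x * f x) (ha : f a ≤ 0) : f b ≤ 0 := by
  obtain ⟨M, hM⟩ := isCompact_Icc.bddAbove_image hc
  have key : ∀ ε > 0, f b ≤ ε * Real.exp ((M + 1) * (b - a)) := fun ε hε => by
    refine image_le_of_deriv_right_lt_deriv_boundary
      (B := fun x => ε * Real.exp ((M + 1) * (x - a)))
      (B' := fun x => ε * (Real.exp ((M + 1) * (x - a)) * ((M + 1) * 1)))
      (fun x hx => (hf x hx).continuousAt.continuousWithinAt)
      (fun x hx => (hf x (Set.Ico_subset_Icc_self hx)).hasDerivWithinAt) ?_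
      (fun x => ((((hasDerivAt_id x).sub_const a).const_mul (M + 1)).exp).const_mul ε) ?_
      (Set.right_mem_Icc.2 hab)
    · simpa using ha.trans hε.le
    · intro x hx hfx
      have hx' := Set.Ico_subset_Icc_self hx
      have hB : 0 < ε * Real.exp ((M + 1) * (x - a)) := by positivity
      have h1 := hle x hx'
      have h2 : c x ≤ M := hM (Set.mem_image_of_mem c hx')
      rw [hfx] at h1
      nlinarith [mul_le_mul_of_nonneg_right h2 hB.le]
  refine le_of_forall_pos_le_add fun δ hδ => ?_
  have h := key (δ / Real.exp ((M + 1) * (b - a))) (by positivity)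
  rwa [div_mul_cancel₀ _ (Real.exp_pos _).ne', ← zero_add δ] at h

/-- **Trace Riccati comparison.** If `Ŝ' + Ŝ² + R̂ = 0` for smooth families of
self-adjoint endomorphisms of a `k`-dimensional inner product space, with
`trace Ŝ(t₀) ≤ k·λ̃(t₀)` and `trace R̂ ≥ k·κ`, where `λ̃' + λ̃² + κ = 0`, then
`trace Ŝ(t) ≤ k·λ̃(t)` on `[t₀, t_max)`. -/
theorem trace_riccati_comparison
    {V : Type*} [NormedAddCommGroup V] [InnerProductSpace ℝ V] [FiniteDimensional ℝ V]
    (k : ℕ) (hk : Module.finrank ℝ V = k)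
    (κ t₀ tmax : ℝ) (ht : t₀ < tmax)
    (S R : ℝ → V →L[ℝ] V)
    (hS_smooth : ContDiffOn ℝ (⊤ : ℕ∞) S (Set.Ico t₀ tmax))
    (hR_smooth : ContDiffOn ℝ (⊤ : ℕ∞) R (Set.Ico t₀ tmax))
    (hS_sym : ∀ t ∈ Set.Ico t₀ tmax, ∀ x y : V, ⟪S t x, y⟫ = ⟪x, S t y⟫)
    (hR_sym : ∀ t ∈ Set.Ico t₀ tmax, ∀ x y : V, ⟪R t x, y⟫ = ⟪x, R t y⟫)
    (hRiccati : ∀ t ∈ Set.Ico t₀ tmax, HasDerivAt S (-((S t).comp (S t)) - R t) t)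
    (lam : ℝ → ℝ)
    (hlam : ∀ t ∈ Set.Ico t₀ tmax, HasDerivAt lam (-(lam t ^ 2) - κ) t)
    (hS0 : LinearMap.trace ℝ V (S t₀ : V →ₗ[ℝ] V) ≤ (k : ℝ) * lam t₀)
    (hRtr : ∀ t ∈ Set.Ico t₀ tmax, (k : ℝ) * κ ≤ LinearMap.trace ℝ V (R t : V →ₗ[ℝ] V)) :
    ∀ t ∈ Set.Ico t₀ tmax, LinearMap.trace ℝ V (S t : V →ₗ[ℝ] V) ≤ (k : ℝ) * lam t := by
  intro t htI
  have hsub : Set.Icc t₀ t ⊆ Set.Ico t₀ tmax := Set.Icc_subset_Ico_right htI.2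
  refine sub_nonpos.1 (nonpos_of_hasDerivAt_le_mul
    (f := fun s => LinearMap.trace ℝ V (S s : V →ₗ[ℝ] V) - k * lam s)
    (c := fun s => -2 * lam s) htI.1
    (fun s hs => (hRiccati s (hsub hs)).linearMap_trace.sub
      ((hlam s (hsub hs)).const_mul (k : ℝ)))
    (fun s hs => ((hlam s (hsub hs)).continuousAt.const_mul _).continuousWithinAt)
    (fun s hs => ?_) (sub_nonpos.2 hS0))
  have hsym : (S s : V →ₗ[ℝ] V).IsSymmetric := hS_sym s (hsub hs)
  have hsq := hsym.two_mul_trace_le_trace_comp_self_add (lam s)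
  have hR := hRtr s (hsub hs)
  rw [hk] at hsq
  simp only [ContinuousLinearMap.toLinearMap_sub, ContinuousLinearMap.toLinearMap_neg,
    ContinuousLinearMap.toLinearMap_comp, map_sub, map_neg]
  linarith
end

section
/- Let V be a k-dimensional real inner product space, κ ∈ ℝ, and t₀ < t_max. Let Ŝ, R̂ : [t₀, t_max) → End(V) be smooth families of self-adjoint endomorphisms satisfying Ŝ'(t) + Ŝ(t)² + R̂(t) = 0 for all t ∈ [t₀, t_max). Let λ̃ : [t₀, t_max) → ℝ be a solution of the scalar Riccati equation with parameter κ, and assume trace Ŝ(t₀) ≤ k·λ̃(t₀) and trace R̂(t) ≥ k·κ for all t ∈ [t₀, t_max). If trace Ŝ(t₁) = k·λ̃(t₁) for some t₁ ∈ (t₀, t_max), then Ŝ(t) = λ̃(t)·id and R̂(t) = κ·id for all t ∈ [t₀, t₁]; moreover every solution J : [t₀, t₁] → V of J''(t) + R̂(t)(J(t)) = 0 with J'(t₀) = λ̃(t₀)·J(t₀) has the form J(t) = f(t)·E for a constant vector E ∈ V and a function f : [t₀, t₁] → ℝ satisfying f'' + κ·f = 0. -/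
open RealInnerProductSpace

/-- The trace of endomorphisms as a continuous linear functional on `V →L[ℝ] V`. -/
noncomputable def traceCLM (V : Type*) [NormedAddCommGroup V] [InnerProductSpace ℝ V]
    [FiniteDimensional ℝ V] : (V →L[ℝ] V) →L[ℝ] ℝ :=
  LinearMap.toContinuousLinearMap ((LinearMap.trace ℝ V).comp (ContinuousLinearMap.coeLM ℝ))

section Trace

variable {V : Type*} [NormedAddCommGroup V] [InnerProductSpace ℝ V] [FiniteDimensional ℝ V]

theorem traceCLM_apply (A : V →L[ℝ] V) :
    traceCLM V A = LinearMap.trace ℝ V (A : V →ₗ[ℝ] V) := rfl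

theorem traceCLM_id :
    traceCLM V (ContinuousLinearMap.id ℝ V) = Module.finrank ℝ V := by
  rw [traceCLM_apply]
  exact LinearMap.trace_id ℝ V

theorem traceCLM_comp_self_eq_sum (A : V →L[ℝ] V) (hA : ∀ x y : V, ⟪A x, y⟫ = ⟪x, A y⟫) :
    traceCLM V (A.comp A) = ∑ i, ‖A (stdOrthonormalBasis ℝ V i)‖ ^ 2 := by
  rw [traceCLM_apply, LinearMap.trace_eq_sum_inner _ (stdOrthonormalBasis ℝ V)]
  refine Finset.sum_congr rfl fun i _ => ?_
  rw [← real_inner_self_eq_norm_sq, hA]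
  rfl

theorem traceCLM_comp_self_nonneg (A : V →L[ℝ] V) (hA : ∀ x y : V, ⟪A x, y⟫ = ⟪x, A y⟫) :
    0 ≤ traceCLM V (A.comp A) := by
  rw [traceCLM_comp_self_eq_sum A hA]
  positivity

theorem eq_zero_of_traceCLM_comp_self_eq_zero (A : V →L[ℝ] V)
    (hA : ∀ x y : V, ⟪A x, y⟫ = ⟪x, A y⟫) (h : traceCLM V (A.comp A) = 0) : A = 0 := by
  rw [traceCLM_comp_self_eq_sum A hA, Finset.sum_eq_zero_iff_of_nonneg (by intros; positivity)] at h
  have h' : (A : V →ₗ[ℝ] V) = 0 := by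
    refine (stdOrthonormalBasis ℝ V).toBasis.ext fun i => ?_
    simpa using h i (Finset.mem_univ i)
  ext x
  exact LinearMap.congr_fun h' x

theorem traceCLM_sub_smul_id_comp_self (A : V →L[ℝ] V) (c : ℝ) :
    traceCLM V ((A - c • ContinuousLinearMap.id ℝ V).comp (A - c • ContinuousLinearMap.id ℝ V)) =
      traceCLM V (A.comp A) - 2 * c * traceCLM V A + Module.finrank ℝ V * c ^ 2 := by
  have : (A - c • ContinuousLinearMap.id ℝ V).comp (A - c • ContinuousLinearMap.id ℝ V) =
      A.comp A - (2 * c) • A + c ^ 2 • ContinuousLinearMap.id ℝ V := by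
    ext x
    simp only [ContinuousLinearMap.comp_apply, sub_apply,
      add_apply, smul_apply, ContinuousLinearMap.id_apply,
      map_sub, map_smul]
    module
  rw [this, map_add, map_sub, map_smul, map_smul, traceCLM_id, smul_eq_mul, smul_eq_mul]
  ring

end Trace

/-- Two derivatives at a point of a nondegenerate closed interval agree when the functions agree
on that interval. -/
theorem HasDerivAt.unique_of_eqOn_Icc {F : Type*} [NormedAddCommGroup F] [NormedSpace ℝ F]
    {f g : ℝ → F} {f' g' : F} {a b t : ℝ} (hab : a < b) (ht : t ∈ Set.Icc a b)
    (hf : HasDerivAt f f' t) (hg : HasDerivAt g g' t) (h : Set.EqOn f g (Set.Icc a b)) :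
    f' = g' :=
  ((uniqueDiffOn_Icc hab) t ht).eq_deriv _ hf.hasDerivWithinAt
    (hg.hasDerivWithinAt.congr h (h ht))

/-- If `u' ≤ p u` on `[a, b]` and `u a ≤ 0 ≤ u b`, then `u` vanishes on `[a, b]`. -/
theorem eqOn_zero_of_deriv_le_mul {u u' p : ℝ → ℝ} {a b : ℝ} (hab : a ≤ b)
    (hp : ContinuousOn p (Set.Icc a b))
    (hu : ∀ t ∈ Set.Icc a b, HasDerivAt u (u' t) t)
    (hle : ∀ t ∈ Set.Icc a b, u' t ≤ p t * u t) (ha : u a ≤ 0) (hb : 0 ≤ u b) :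
    Set.EqOn u 0 (Set.Icc a b) := by
  set q : ℝ → ℝ := Set.IccExtend hab ((Set.Icc a b).domRestrict p) with hq
  have hqc : Continuous q := hp.domRestrict.Icc_extend'
  have hqp : ∀ t ∈ Set.Icc a b, q t = p t := fun t ht => by
    rw [hq, Set.IccExtend_of_mem hab _ ht]; rfl
  have hP : ∀ t, HasDerivAt (fun t => ∫ s in a..t, q s) (q t) t := fun t =>
    (hqc.integral_hasStrictDerivAt a t).hasDerivAt
  set m : ℝ → ℝ := fun t => Real.exp (-∫ s in a..t, q s) with hm
  have hm_pos : ∀ t, 0 < m t := fun t => Real.exp_pos _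
  have hmd : ∀ t, HasDerivAt m (m t * -q t) t := fun t => (hP t).neg.exp
  have hd : ∀ t ∈ Set.Icc a b,
      HasDerivAt (fun t => m t * u t) (m t * -q t * u t + m t * u' t) t := fun t ht =>
    (hmd t).mul (hu t ht)
  have hanti : AntitoneOn (fun t => m t * u t) (Set.Icc a b) := by
    refine antitoneOn_of_deriv_nonpos (convex_Icc a b)
      (fun t ht => (hd t ht).continuousAt.continuousWithinAt)
      (fun t ht => (hd t (interior_subset ht)).differentiableAt.differentiableWithinAt)
      fun t ht => ?_
    have ht := interior_subset ht
    rw [(hd t ht).deriv, hqp t ht]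
    nlinarith [mul_nonneg (hm_pos t).le (sub_nonneg.2 (hle t ht))]
  intro t ht
  have h1 := hanti (Set.left_mem_Icc.2 hab) ht ht.1
  have h2 := hanti ht (Set.right_mem_Icc.2 hab) ht.2
  have h3 : m t * u t = 0 := le_antisymm
    (h1.trans (mul_nonpos_of_nonneg_of_nonpos (hm_pos a).le ha))
    ((mul_nonneg (hm_pos b).le hb).trans h2)
  exact (mul_eq_zero.1 h3).resolve_left (hm_pos t).ne'

/-- The equation `f'' + κ f = 0` has a global solution with prescribed initial data at `a`. -/
theorem exists_solution_deriv_deriv_eq_neg_mul (κ a x y : ℝ) :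
    ∃ f g : ℝ → ℝ, (∀ t, HasDerivAt f (g t) t) ∧ (∀ t, HasDerivAt g (-(κ * f t)) t) ∧
      f a = x ∧ g a = y := by
  rcases lt_trichotomy κ 0 with hκ | rfl | hκ
  · obtain ⟨w, hw, rfl⟩ : ∃ w : ℝ, w ≠ 0 ∧ κ = -w ^ 2 :=
      ⟨√(-κ), (Real.sqrt_pos.2 (by linarith)).ne', by rw [Real.sq_sqrt (by linarith)]; ring⟩
    have hl : ∀ t, HasDerivAt (fun t : ℝ => w * (t - a)) w t := fun t => by
      simpa using ((hasDerivAt_id t).sub_const a).const_mul w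
    refine ⟨fun t => x * Real.cosh (w * (t - a)) + y / w * Real.sinh (w * (t - a)),
      fun t => x * w * Real.sinh (w * (t - a)) + y * Real.cosh (w * (t - a)),
      fun t => ?_, fun t => ?_, by simp, by simp⟩
    · refine (((hl t).cosh.const_mul x).fun_add ((hl t).sinh.const_mul (y / w))).congr_deriv ?_
      field_simp
    · refine (((hl t).sinh.const_mul (x * w)).fun_add ((hl t).cosh.const_mul y)).congr_deriv ?_
      field_simp
  · refine ⟨fun t => x + y * (t - a), fun _ => y, fun t => ?_, fun t => ?_, by simp, rfl⟩
    · simpa using (((hasDerivAt_id t).sub_const a).const_mul y).const_add x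
    · simpa using hasDerivAt_const t y
  · obtain ⟨w, hw, rfl⟩ : ∃ w : ℝ, w ≠ 0 ∧ κ = w ^ 2 :=
      ⟨√κ, (Real.sqrt_pos.2 hκ).ne', (Real.sq_sqrt hκ.le).symm⟩
    have hl : ∀ t, HasDerivAt (fun t : ℝ => w * (t - a)) w t := fun t => by
      simpa using ((hasDerivAt_id t).sub_const a).const_mul w
    refine ⟨fun t => x * Real.cos (w * (t - a)) + y / w * Real.sin (w * (t - a)),
      fun t => -(x * w) * Real.sin (w * (t - a)) + y * Real.cos (w * (t - a)),
      fun t => ?_, fun t => ?_, by simp, by simp⟩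
    · refine (((hl t).cos.const_mul x).fun_add ((hl t).sin.const_mul (y / w))).congr_deriv ?_
      field_simp
    · refine (((hl t).sin.const_mul (-(x * w))).fun_add ((hl t).cos.const_mul y)).congr_deriv ?_
      field_simp
      ring

/-- Solutions of `J'' + κ J = 0` on `[a, b]` are determined by their initial data at `a`. -/
theorem eqOn_Icc_of_deriv_deriv_eq_neg_smul {F : Type*} [NormedAddCommGroup F] [NormedSpace ℝ F]
    {κ a b : ℝ} {J J' K K' : ℝ → F}
    (hJ : ∀ t ∈ Set.Icc a b, HasDerivAt J (J' t) t)
    (hJ' : ∀ t ∈ Set.Icc a b, HasDerivAt J' (-(κ • J t)) t)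
    (hK : ∀ t ∈ Set.Icc a b, HasDerivAt K (K' t) t)
    (hK' : ∀ t ∈ Set.Icc a b, HasDerivAt K' (-(κ • K t)) t)
    (h : J a = K a) (h' : J' a = K' a) : Set.EqOn J K (Set.Icc a b) := by
  let L : F × F →L[ℝ] F × F :=
    (ContinuousLinearMap.snd ℝ F F).prod (-(κ • ContinuousLinearMap.fst ℝ F F))
  have hJd : ∀ t ∈ Set.Icc a b, HasDerivAt (fun t => (J t, J' t)) (L (J t, J' t)) t :=
    fun t ht => (hJ t ht).prodMk (hJ' t ht)
  have hKd : ∀ t ∈ Set.Icc a b, HasDerivAt (fun t => (K t, K' t)) (L (K t, K' t)) t :=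
    fun t ht => (hK t ht).prodMk (hK' t ht)
  have key := ODE_solution_unique (v := fun _ => L) (fun _ => L.lipschitz)
    (fun t ht => (hJd t ht).continuousAt.continuousWithinAt)
    (fun t ht => (hJd t (Set.Ico_subset_Icc_self ht)).hasDerivWithinAt)
    (fun t ht => (hKd t ht).continuousAt.continuousWithinAt)
    (fun t ht => (hKd t (Set.Ico_subset_Icc_self ht)).hasDerivWithinAt)
    (Prod.ext h h')
  exact fun t ht => congrArg Prod.fst (key ht)

/-- **Rigidity in the trace Riccati comparison.** If `Ŝ' + Ŝ² + R̂ = 0` for smooth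
families of self-adjoint endomorphisms of a `k`-dimensional inner product space,
with `trace Ŝ(t₀) ≤ k·λ̃(t₀)` and `trace R̂ ≥ k·κ` (`λ̃' + λ̃² + κ = 0`), and if
`trace Ŝ(t₁) = k·λ̃(t₁)` for some `t₁ ∈ (t₀, t_max)`, then `Ŝ = λ̃·id` and
`R̂ = κ·id` on `[t₀, t₁]`, and every solution of `J'' + R̂ J = 0` on `[t₀, t₁]`
with `J'(t₀) = λ̃(t₀)·J(t₀)` has the form `J(t) = f(t)·E` with `E` constant and
`f'' + κ·f = 0`. -/
theorem trace_riccati_comparison_rigidity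
    {V : Type*} [NormedAddCommGroup V] [InnerProductSpace ℝ V] [FiniteDimensional ℝ V]
    (k : ℕ) (hk : Module.finrank ℝ V = k)
    (κ t₀ tmax : ℝ) (ht : t₀ < tmax)
    (S R : ℝ → V →L[ℝ] V)
    (hS_smooth : ContDiffOn ℝ (⊤ : ℕ∞) S (Set.Ico t₀ tmax))
    (hR_smooth : ContDiffOn ℝ (⊤ : ℕ∞) R (Set.Ico t₀ tmax))
    (hS_sym : ∀ t ∈ Set.Ico t₀ tmax, ∀ x y : V, ⟪S t x, y⟫ = ⟪x, S t y⟫)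
    (hR_sym : ∀ t ∈ Set.Ico t₀ tmax, ∀ x y : V, ⟪R t x, y⟫ = ⟪x, R t y⟫)
    (hRiccati : ∀ t ∈ Set.Ico t₀ tmax, HasDerivAt S (-((S t).comp (S t)) - R t) t)
    (lam : ℝ → ℝ)
    (hlam : ∀ t ∈ Set.Ico t₀ tmax, HasDerivAt lam (-(lam t ^ 2) - κ) t)
    (hS0 : LinearMap.trace ℝ V (S t₀ : V →ₗ[ℝ] V) ≤ (k : ℝ) * lam t₀)
    (hRtr : ∀ t ∈ Set.Ico t₀ tmax, (k : ℝ) * κ ≤ LinearMap.trace ℝ V (R t : V →ₗ[ℝ] V))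
    (t₁ : ℝ) (ht₁ : t₁ ∈ Set.Ioo t₀ tmax)
    (heq : LinearMap.trace ℝ V (S t₁ : V →ₗ[ℝ] V) = (k : ℝ) * lam t₁) :
    (∀ t ∈ Set.Icc t₀ t₁,
      S t = lam t • ContinuousLinearMap.id ℝ V ∧ R t = κ • ContinuousLinearMap.id ℝ V) ∧
    ∀ J : ℝ → V,
      (∀ t ∈ Set.Icc t₀ t₁, HasDerivAt J (deriv J t) t) →
      (∀ t ∈ Set.Icc t₀ t₁, HasDerivAt (deriv J) (-(R t (J t))) t) →
      deriv J t₀ = lam t₀ • J t₀ →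
      ∃ (E : V) (f : ℝ → ℝ),
        (∀ t ∈ Set.Icc t₀ t₁, HasDerivAt f (deriv f t) t) ∧
        (∀ t ∈ Set.Icc t₀ t₁, HasDerivAt (deriv f) (-(κ * f t)) t) ∧
        ∀ t ∈ Set.Icc t₀ t₁, J t = f t • E := by
  have hsub : Set.Icc t₀ t₁ ⊆ Set.Ico t₀ tmax := fun t h => ⟨h.1, h.2.trans_lt ht₁.2⟩
  set A : ℝ → V →L[ℝ] V := fun t => S t - lam t • ContinuousLinearMap.id ℝ V with hA
  have hA_sym : ∀ t ∈ Set.Icc t₀ t₁, ∀ x y : V, ⟪A t x, y⟫ = ⟪x, A t y⟫ := fun t h x y => by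
    simp [hA, inner_sub_left, inner_sub_right, real_inner_smul_left, real_inner_smul_right,
      hS_sym t (hsub h)]
  have hA_tr : ∀ t, traceCLM V ((A t).comp (A t)) =
      traceCLM V ((S t).comp (S t)) - 2 * lam t * traceCLM V (S t) + k * lam t ^ 2 := fun t => by
    rw [hA, traceCLM_sub_smul_id_comp_self, hk]
  simp only [← traceCLM_apply] at hS0 hRtr heq
  have hu : ∀ t ∈ Set.Icc t₀ t₁, HasDerivAt (fun t => traceCLM V (S t) - k * lam t)
      (-traceCLM V ((A t).comp (A t)) - (traceCLM V (R t) - k * κ) +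
        -2 * lam t * (traceCLM V (S t) - k * lam t)) t := fun t h => by
    refine (((traceCLM V).hasFDerivAt.comp_hasDerivAt t (hRiccati t (hsub h))).fun_sub
      ((hlam t (hsub h)).const_mul (k : ℝ))).congr_deriv ?_
    rw [hA_tr, map_sub, map_neg]
    ring
  have hu0 : Set.EqOn (fun t => traceCLM V (S t) - k * lam t) 0 (Set.Icc t₀ t₁) :=
    eqOn_zero_of_deriv_le_mul (p := fun t => -2 * lam t) ht₁.1.le
      (continuousOn_const.mul fun t h => (hlam t (hsub h)).continuousAt.continuousWithinAt) hu
      (fun t h => by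
        linarith [traceCLM_comp_self_nonneg _ (hA_sym t h), hRtr t (hsub h)])
      (by linarith) (by linarith)
  have hSlam : Set.EqOn S (fun t => lam t • ContinuousLinearMap.id ℝ V) (Set.Icc t₀ t₁) := by
    intro t h
    have hd := (hu t h).unique_of_eqOn_Icc ht₁.1 h (hasDerivAt_const t (0 : ℝ)) hu0
    have hut : traceCLM V (S t) - k * lam t = 0 := hu0 h
    rw [hut] at hd
    have hnn := traceCLM_comp_self_nonneg _ (hA_sym t h)
    exact sub_eq_zero.1 (eq_zero_of_traceCLM_comp_self_eq_zero _ (hA_sym t h)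
      (by linarith [hRtr t (hsub h)]))
  have hRκ : ∀ t ∈ Set.Icc t₀ t₁, R t = κ • ContinuousLinearMap.id ℝ V := by
    intro t h
    have hd := (hRiccati t (hsub h)).unique_of_eqOn_Icc ht₁.1 h
      ((hlam t (hsub h)).smul_const (ContinuousLinearMap.id ℝ V)) hSlam
    rw [hSlam h] at hd
    ext x
    have hx := congrArg (fun B : V →L[ℝ] V => B x) hd
    simp only [ContinuousLinearMap.comp_apply, sub_apply,
      neg_apply, smul_apply,
      ContinuousLinearMap.id_apply] at hx ⊢
    rw [sub_eq_iff_eq_add, ← sub_eq_iff_eq_add'] at hx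
    rw [← hx]
    module
  refine ⟨fun t h => ⟨hSlam h, hRκ t h⟩, fun J hJ hJ' hJ0 => ?_⟩
  obtain ⟨f, g, hf, hg, hf0, hg0⟩ := exists_solution_deriv_deriv_eq_neg_mul κ t₀ 1 (lam t₀)
  have hfg : deriv f = g := funext fun t => (hf t).deriv
  refine ⟨J t₀, f, fun t _ => hfg ▸ hf t, fun t _ => hfg ▸ hg t,
    eqOn_Icc_of_deriv_deriv_eq_neg_smul (κ := κ) hJ (fun t h => ?_)
      (fun t _ => (hf t).smul_const (J t₀)) (fun t _ => ?_) ?_ ?_⟩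
  · simpa [hRκ t h] using hJ' t h
  · simpa [mul_smul] using (hg t).smul_const (J t₀)
  · simp [hf0]
  · rw [hJ0, hg0]
end

section
/- Let V be a k-dimensional real inner product space, κ ∈ ℝ, and t₀ < t_max. Let Ŝ, R̂ : [t₀, t_max) → End(V) be smooth families of self-adjoint endomorphisms satisfying Ŝ'(t) + Ŝ(t)² + R̂(t) = 0 for all t ∈ [t₀, t_max). Let λ̃ : [t₀, t_max) → ℝ be a solution of the scalar Riccati equation with parameter κ such that λ̃(t) → −∞ as t → t_max from the left. If trace Ŝ(t₀) ≤ k·λ̃(t₀) and trace R̂(t) ≥ k·κ for all t ∈ [t₀, t_max), then Ŝ(t) = λ̃(t)·id and R̂(t) = κ·id for all t ∈ [t₀, t_max). -/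
open RealInnerProductSpace

/-- If `u' ≤ -a u` with `a` continuous, then `u` becomes antitone after multiplication by the
integrating factor `exp (∫ a)`. -/
lemma exists_antitoneOn_mul_exp {u u' a : ℝ → ℝ} {x y : ℝ} (hxy : x ≤ y)
    (hu : ∀ t ∈ Set.Icc x y, HasDerivAt u (u' t) t)
    (ha : ContinuousOn a (Set.Icc x y))
    (hle : ∀ t ∈ Set.Icc x y, u' t ≤ -(a t * u t)) :
    ∃ A : ℝ → ℝ, AntitoneOn (fun t => u t * Real.exp (A t)) (Set.Icc x y) := by
  have hc : Continuous (Set.IccExtend hxy ((Set.Icc x y).domRestrict a)) :=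
    (continuousOn_iff_continuous_domRestrict.1 ha).Icc_extend'
  set b := Set.IccExtend hxy ((Set.Icc x y).domRestrict a) with hb
  have hba : ∀ t ∈ Set.Icc x y, b t = a t := fun t h => by
    rw [hb, Set.IccExtend_of_mem hxy _ h]; rfl
  have hA : ∀ t, HasDerivAt (fun t => ∫ r in x..t, b r) (b t) t := fun t =>
    hc.integral_hasStrictDerivAt x t |>.hasDerivAt
  have hd : ∀ t ∈ Set.Icc x y, HasDerivAt (fun t => u t * Real.exp (∫ r in x..t, b r))
      (u' t * Real.exp (∫ r in x..t, b r) +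
        u t * (Real.exp (∫ r in x..t, b r) * b t)) t := fun t h =>
    (hu t h).mul (hA t).exp
  refine ⟨_, antitoneOn_of_hasDerivWithinAt_nonpos (convex_Icc x y)
    (fun t h => (hd t h).continuousAt.continuousWithinAt)
    (fun t h => (hd t (interior_subset h)).hasDerivWithinAt) fun t h => ?_⟩
  have h' := interior_subset h
  rw [hba t h']
  have := mul_nonneg (sub_nonneg.2 (hle t h')) (Real.exp_pos (∫ r in x..t, b r)).le
  nlinarith

lemma nonpos_and_neg_of_deriv_le {u u' a : ℝ → ℝ} {x y : ℝ} (hxy : x ≤ y)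
    (hu : ∀ t ∈ Set.Icc x y, HasDerivAt u (u' t) t)
    (ha : ContinuousOn a (Set.Icc x y))
    (hle : ∀ t ∈ Set.Icc x y, u' t ≤ -(a t * u t)) :
    (u x ≤ 0 → u y ≤ 0) ∧ (u x < 0 → u y < 0) := by
  obtain ⟨A, hA⟩ := exists_antitoneOn_mul_exp hxy hu ha hle
  have h : u y * Real.exp (A y) ≤ u x * Real.exp (A x) :=
    hA (Set.left_mem_Icc.2 hxy) (Set.right_mem_Icc.2 hxy) hxy
  have hx := Real.exp_pos (A x)
  have hy := Real.exp_pos (A y)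
  constructor
  · intro h0
    by_contra! h1
    nlinarith [mul_pos h1 hy, mul_nonneg (neg_nonneg.2 h0) hx.le]
  · intro h0
    by_contra! h1
    nlinarith [mul_nonneg h1 hy.le, mul_pos (neg_pos.2 h0) hx]

/-- A subsolution of the Riccati equation lying strictly below a solution that blows down at `T`
cannot exist up to time `T`, provided both are negative. -/
lemma not_riccati_subsolution_lt {κ x T : ℝ} (hx : x < T) {s s' lam : ℝ → ℝ}
    (hs : ∀ t ∈ Set.Ico x T, HasDerivAt s (s' t) t)
    (hs' : ∀ t ∈ Set.Ico x T, s' t ≤ -(s t ^ 2) - κ)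
    (hlam : ∀ t ∈ Set.Ico x T, HasDerivAt lam (-(lam t ^ 2) - κ) t)
    (hbot : Filter.Tendsto lam (nhdsWithin T (Set.Iio T)) Filter.atBot)
    (hlam1 : ∀ t ∈ Set.Ico x T, lam t ≤ -1)
    (hlt : ∀ t ∈ Set.Ico x T, s t < lam t) : False := by
  set q : ℝ → ℝ := fun t => (s t)⁻¹ - (lam t)⁻¹ with hq
  have hqpos : ∀ t ∈ Set.Ico x T, 0 < q t := fun t h => by
    have h1 := hlam1 t h
    exact sub_pos.2 ((inv_lt_inv_of_neg (by linarith) (by linarith [hlt t h])).2 (hlt t h))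
  have hd : ∀ t ∈ Set.Ico x T, HasDerivAt (fun t => q t * Real.exp (2 * |κ| * t))
      ((-s' t / s t ^ 2 - -(-(lam t ^ 2) - κ) / lam t ^ 2) * Real.exp (2 * |κ| * t) +
        q t * (Real.exp (2 * |κ| * t) * (2 * |κ|))) t := fun t h => by
    have h1 := hlam1 t h
    have h2 := hlt t h
    have h3 : HasDerivAt (fun t : ℝ => 2 * |κ| * t) (2 * |κ|) t := by
      simpa using (hasDerivAt_id t).const_mul (2 * |κ|)
    exact (((hs t h).fun_inv (by linarith)).sub ((hlam t h).fun_inv (by linarith))).mul h3.exp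
  have hmono : MonotoneOn (fun t => q t * Real.exp (2 * |κ| * t)) (Set.Ico x T) := by
    refine monotoneOn_of_hasDerivWithinAt_nonneg (convex_Ico x T)
      (fun t h => (hd t h).continuousAt.continuousWithinAt)
      (fun t h => (hd t (interior_subset h)).hasDerivWithinAt) fun t h => ?_
    have h' := interior_subset h
    have h1 := hlam1 t h'
    have h2 := hlt t h'
    have h3 := hs' t h'
    have hl0 : lam t ≠ 0 := by linarith
    have hs0 : s t ≠ 0 := by linarith
    have e1 : -(-(lam t ^ 2) - κ) / lam t ^ 2 = 1 + κ * (lam t)⁻¹ ^ 2 := by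
      field_simp
      ring
    have e2 : 1 + κ * (s t)⁻¹ ^ 2 ≤ -s' t / s t ^ 2 := by
      rw [le_div_iff₀ (by positivity)]
      have : (1 + κ * (s t)⁻¹ ^ 2) * s t ^ 2 = s t ^ 2 + κ := by field_simp
      linarith
    have hl : -1 ≤ (lam t)⁻¹ := by
      have := inv_le_one_of_one_le₀ (a := -lam t) (by linarith)
      rw [inv_neg] at this
      linarith
    have hl' : (s t)⁻¹ < 0 := inv_lt_zero.2 (by linarith)
    have hqt := hqpos t h'
    have hqe : q t = (s t)⁻¹ - (lam t)⁻¹ := rfl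
    have e3 : -(2 * |κ|) ≤ κ * ((s t)⁻¹ + (lam t)⁻¹) := by
      have : |κ * ((s t)⁻¹ + (lam t)⁻¹)| ≤ |κ| * 2 := by
        rw [abs_mul]
        refine mul_le_mul_of_nonneg_left (abs_le.2 ⟨?_, ?_⟩) (abs_nonneg κ) <;> linarith
      linarith [neg_abs_le (κ * ((s t)⁻¹ + (lam t)⁻¹))]
    have e4 := mul_le_mul_of_nonneg_right e3 hqt.le
    have e5 : 0 ≤ (-s' t / s t ^ 2 - -(-(lam t ^ 2) - κ) / lam t ^ 2) + q t * (2 * |κ|) := by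
      rw [e1]
      rw [hqe] at e4 ⊢
      nlinarith
    have := mul_nonneg e5 (Real.exp_pos (2 * |κ| * t)).le
    nlinarith
  have hxm : x ∈ Set.Ico x T := ⟨le_rfl, hx⟩
  have hlim : Filter.Tendsto (fun t => -(lam t)⁻¹ * Real.exp (2 * |κ| * t))
      (nhdsWithin T (Set.Iio T)) (nhds (-0 * Real.exp (2 * |κ| * T))) := by
    refine (Filter.Tendsto.neg (tendsto_inv_atBot_zero.comp hbot)).mul ?_
    exact (Continuous.tendsto (by fun_prop) T).mono_left nhdsWithin_le_nhds
  have hle : q x * Real.exp (2 * |κ| * x) ≤ -0 * Real.exp (2 * |κ| * T) := by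
    refine ge_of_tendsto hlim ?_
    filter_upwards [Ico_mem_nhdsLT hx] with t h
    refine (hmono hxm h h.1).trans (mul_le_mul_of_nonneg_right ?_ (Real.exp_pos _).le)
    have : (s t)⁻¹ < 0 := inv_lt_zero.2 (by linarith [hlam1 t h, hlt t h])
    simp only [hq]
    linarith
  have := mul_pos (hqpos x hxm) (Real.exp_pos (2 * |κ| * x))
  linarith

/-- Scalar rigidity: a Riccati subsolution starting below a solution that blows down at `T`
coincides with it on `[x, T)`. -/
lemma riccati_subsolution_eq {κ x T : ℝ} {s s' lam : ℝ → ℝ}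
    (hs : ∀ t ∈ Set.Ico x T, HasDerivAt s (s' t) t)
    (hs' : ∀ t ∈ Set.Ico x T, s' t ≤ -(s t ^ 2) - κ)
    (hlam : ∀ t ∈ Set.Ico x T, HasDerivAt lam (-(lam t ^ 2) - κ) t)
    (hbot : Filter.Tendsto lam (nhdsWithin T (Set.Iio T)) Filter.atBot)
    (h0 : s x ≤ lam x) : ∀ t ∈ Set.Ico x T, s t = lam t := by
  have key : ∀ y z, x ≤ y → y ≤ z → z < T →
      (s y - lam y ≤ 0 → s z - lam z ≤ 0) ∧ (s y - lam y < 0 → s z - lam z < 0) := by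
    intro y z hxy hyz hz
    have hsub : ∀ t ∈ Set.Icc y z, t ∈ Set.Ico x T := fun t h =>
      ⟨hxy.trans h.1, h.2.trans_lt hz⟩
    refine nonpos_and_neg_of_deriv_le (u := fun t => s t - lam t)
      (a := fun t => s t + lam t) hyz
      (fun t h => (hs t (hsub t h)).sub (hlam t (hsub t h)))
      (fun t h => ((hs t (hsub t h)).continuousAt.add
        (hlam t (hsub t h)).continuousAt).continuousWithinAt) fun t h => ?_
    have := hs' t (hsub t h)
    nlinarith
  intro t h
  by_contra hne
  have hle := (key x t le_rfl h.1 h.2).1 (by linarith)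
  have hlt : s t - lam t < 0 := lt_of_le_of_ne hle (sub_ne_zero.2 hne)
  obtain ⟨l, hl, hl'⟩ := mem_nhdsLT_iff_exists_Ico_subset.1
    (hbot.eventually (Filter.eventually_le_atBot (-1)))
  have hm : max t l < T := max_lt h.2 hl
  have hsub : ∀ r ∈ Set.Ico (max t l) T, r ∈ Set.Ico x T := fun r hr =>
    ⟨h.1.trans ((le_max_left _ _).trans hr.1), hr.2⟩
  exact not_riccati_subsolution_lt hm (fun r hr => hs r (hsub r hr))
    (fun r hr => hs' r (hsub r hr)) (fun r hr => hlam r (hsub r hr)) hbot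
    (fun r hr => hl' ⟨(le_max_right _ _).trans hr.1, hr.2⟩)
    fun r hr => sub_neg.1 ((key t r h.1 ((le_max_left _ _).trans hr.1) hr.2).2 hlt)

section Trace

variable {V : Type*} [NormedAddCommGroup V] [InnerProductSpace ℝ V]

lemma sub_smul_id_symm {A : V →L[ℝ] V} (hA : ∀ x y : V, ⟪A x, y⟫ = ⟪x, A y⟫) (c : ℝ) (x y : V) :
    ⟪(A - c • ContinuousLinearMap.id ℝ V) x, y⟫ =
      ⟪x, (A - c • ContinuousLinearMap.id ℝ V) y⟫ := by
  simp [inner_sub_left, inner_sub_right, inner_smul_left, inner_smul_right, hA]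

variable [FiniteDimensional ℝ V]

lemma trace_comp_self_eq_sum_norm_sq {A : V →L[ℝ] V} (hA : ∀ x y : V, ⟪A x, y⟫ = ⟪x, A y⟫) :
    LinearMap.trace ℝ V (A.comp A : V →L[ℝ] V) =
      ∑ i, ‖A (stdOrthonormalBasis ℝ V i)‖ ^ 2 := by
  rw [LinearMap.trace_eq_sum_inner _ (stdOrthonormalBasis ℝ V)]
  refine Finset.sum_congr rfl fun i _ => ?_
  rw [← real_inner_self_eq_norm_sq, hA]
  rfl

lemma trace_comp_self_nonneg {A : V →L[ℝ] V} (hA : ∀ x y : V, ⟪A x, y⟫ = ⟪x, A y⟫) :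
    0 ≤ LinearMap.trace ℝ V (A.comp A : V →L[ℝ] V) := by
  rw [trace_comp_self_eq_sum_norm_sq hA]
  positivity

lemma eq_zero_of_trace_comp_self_nonpos {A : V →L[ℝ] V}
    (hA : ∀ x y : V, ⟪A x, y⟫ = ⟪x, A y⟫)
    (h : LinearMap.trace ℝ V (A.comp A : V →L[ℝ] V) ≤ 0) : A = 0 := by
  rw [trace_comp_self_eq_sum_norm_sq hA] at h
  have h0 := (Finset.sum_eq_zero_iff_of_nonneg fun i _ => by positivity).1
    (h.antisymm (Finset.sum_nonneg fun i _ => by positivity))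
  apply ContinuousLinearMap.coe_injective
  refine (stdOrthonormalBasis ℝ V).toBasis.ext fun i => ?_
  simpa using h0 i (Finset.mem_univ i)

lemma trace_sub_smul_id_comp_self (A : V →L[ℝ] V) (c : ℝ) :
    LinearMap.trace ℝ V ((A - c • ContinuousLinearMap.id ℝ V).comp
      (A - c • ContinuousLinearMap.id ℝ V) : V →L[ℝ] V) =
    LinearMap.trace ℝ V (A.comp A : V →L[ℝ] V) - 2 * c * LinearMap.trace ℝ V (A : V →ₗ[ℝ] V) +
      Module.finrank ℝ V * c ^ 2 := by
  have h : (((A - c • ContinuousLinearMap.id ℝ V).comp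
      (A - c • ContinuousLinearMap.id ℝ V) : V →L[ℝ] V) : V →ₗ[ℝ] V) =
      ((A.comp A : V →L[ℝ] V) : V →ₗ[ℝ] V) - (2 * c) • (A : V →ₗ[ℝ] V) +
        c ^ 2 • LinearMap.id := by
    ext v
    simp
    module
  rw [h, map_add, map_sub, map_smul, map_smul, LinearMap.trace_id]
  simp only [smul_eq_mul]
  ring

lemma HasDerivAt.trace {S : ℝ → V →L[ℝ] V} {S' : V →L[ℝ] V} {t : ℝ} (h : HasDerivAt S S' t) :
    HasDerivAt (fun t => LinearMap.trace ℝ V (S t : V →ₗ[ℝ] V))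
      (LinearMap.trace ℝ V (S' : V →ₗ[ℝ] V)) t :=
  (LinearMap.toContinuousLinearMap
    (LinearMap.trace ℝ V ∘ₗ ContinuousLinearMap.coeLM ℝ)).hasFDerivAt.comp_hasDerivAt t h

end Trace

/-- Two functions agreeing on `[x, T)` have the same two-sided derivatives there. -/
lemma HasDerivAt.unique_of_eqOn_Ico {F : Type*} [NormedAddCommGroup F] [NormedSpace ℝ F]
    {f g : ℝ → F} {f' g' : F} {x T t : ℝ} (ht : t ∈ Set.Ico x T)
    (hf : HasDerivAt f f' t) (hg : HasDerivAt g g' t) (h : Set.EqOn f g (Set.Ico x T)) :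
    f' = g' :=
  (uniqueDiffOn_Ico x T t ht).eq_deriv _ hf.hasDerivWithinAt
    (hg.hasDerivWithinAt.congr h (h ht))

/-- **Rigidity when the comparison function blows down.** If `Ŝ' + Ŝ² + R̂ = 0` on
`[t₀, t_max)` for smooth families of self-adjoint endomorphisms of a
`k`-dimensional inner product space, `λ̃' + λ̃² + κ = 0` with `λ̃(t) → −∞` as
`t → t_max⁻`, `trace Ŝ(t₀) ≤ k·λ̃(t₀)`, and `trace R̂ ≥ k·κ`, then `Ŝ = λ̃·id` and
`R̂ = κ·id` on `[t₀, t_max)`. -/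
theorem trace_riccati_blowdown_rigidity
    {V : Type*} [NormedAddCommGroup V] [InnerProductSpace ℝ V] [FiniteDimensional ℝ V]
    (k : ℕ) (hk : Module.finrank ℝ V = k)
    (κ t₀ tmax : ℝ) (ht : t₀ < tmax)
    (S R : ℝ → V →L[ℝ] V)
    (hS_smooth : ContDiffOn ℝ (⊤ : ℕ∞) S (Set.Ico t₀ tmax))
    (hR_smooth : ContDiffOn ℝ (⊤ : ℕ∞) R (Set.Ico t₀ tmax))
    (hS_sym : ∀ t ∈ Set.Ico t₀ tmax, ∀ x y : V, ⟪S t x, y⟫ = ⟪x, S t y⟫)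
    (hR_sym : ∀ t ∈ Set.Ico t₀ tmax, ∀ x y : V, ⟪R t x, y⟫ = ⟪x, R t y⟫)
    (hRiccati : ∀ t ∈ Set.Ico t₀ tmax, HasDerivAt S (-((S t).comp (S t)) - R t) t)
    (lam : ℝ → ℝ)
    (hlam : ∀ t ∈ Set.Ico t₀ tmax, HasDerivAt lam (-(lam t ^ 2) - κ) t)
    (hlam_bot : Filter.Tendsto lam (nhdsWithin tmax (Set.Iio tmax)) Filter.atBot)
    (hS0 : LinearMap.trace ℝ V (S t₀ : V →ₗ[ℝ] V) ≤ (k : ℝ) * lam t₀)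
    (hRtr : ∀ t ∈ Set.Ico t₀ tmax, (k : ℝ) * κ ≤ LinearMap.trace ℝ V (R t : V →ₗ[ℝ] V)) :
    ∀ t ∈ Set.Ico t₀ tmax,
      S t = lam t • ContinuousLinearMap.id ℝ V ∧ R t = κ • ContinuousLinearMap.id ℝ V := by
  rcases Nat.eq_zero_or_pos k with rfl | hkpos
  · have : Subsingleton V := Module.finrank_zero_iff.1 hk
    exact fun t _ => ⟨Subsingleton.elim _ _, Subsingleton.elim _ _⟩
  have hk0 : (0 : ℝ) < k := Nat.cast_pos.2 hkpos
  set τ : ℝ → ℝ := fun t => LinearMap.trace ℝ V (S t : V →ₗ[ℝ] V) with hτ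
  set σ : ℝ → ℝ := fun t => LinearMap.trace ℝ V ((S t).comp (S t) : V →L[ℝ] V) with hσ
  set ρ : ℝ → ℝ := fun t => LinearMap.trace ℝ V (R t : V →ₗ[ℝ] V) with hρ
  have hτ' : ∀ t ∈ Set.Ico t₀ tmax, HasDerivAt τ (-σ t - ρ t) t := fun t h => by
    have := (hRiccati t h).trace
    rwa [ContinuousLinearMap.toLinearMap_sub, ContinuousLinearMap.toLinearMap_neg, map_sub, map_neg]
      at this
  have htr : ∀ t c, LinearMap.trace ℝ V ((S t - c • ContinuousLinearMap.id ℝ V).comp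
      (S t - c • ContinuousLinearMap.id ℝ V) : V →L[ℝ] V) = σ t - 2 * c * τ t + k * c ^ 2 :=
    fun t c => by rw [trace_sub_smul_id_comp_self, hk]
  have hCS : ∀ t ∈ Set.Ico t₀ tmax, k * (τ t / k) ^ 2 ≤ σ t := fun t h => by
    have h1 := trace_comp_self_nonneg (sub_smul_id_symm (hS_sym t h) (τ t / k))
    rw [htr] at h1
    have h2 : 2 * (τ t / k) * τ t = 2 * (k * (τ t / k) ^ 2) := by field_simp
    linarith
  have hmean : ∀ t ∈ Set.Ico t₀ tmax, τ t / k = lam t := by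
    refine riccati_subsolution_eq (s' := fun t => (-σ t - ρ t) / k)
      (fun t h => (hτ' t h).div_const _) (fun t h => ?_) hlam hlam_bot ?_
    · rw [div_le_iff₀ hk0]
      have h1 := hCS t h
      have h2 : (k : ℝ) * κ ≤ ρ t := hRtr t h
      linarith
    · rw [div_le_iff₀ hk0, mul_comm]
      exact hS0
  have hτlam : ∀ t ∈ Set.Ico t₀ tmax, τ t = k * lam t := fun t h => by
    rw [← hmean t h]
    field_simp
  have hS : Set.EqOn S (fun t => lam t • ContinuousLinearMap.id ℝ V) (Set.Ico t₀ tmax) := by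
    intro t h
    have h1 : -σ t - ρ t = k * (-(lam t ^ 2) - κ) :=
      (hτ' t h).unique_of_eqOn_Ico h ((hlam t h).const_mul (k : ℝ)) hτlam
    have h2 : (k : ℝ) * κ ≤ ρ t := hRtr t h
    refine sub_eq_zero.1 (eq_zero_of_trace_comp_self_nonpos
      (sub_smul_id_symm (hS_sym t h) (lam t)) ?_)
    rw [htr, hτlam t h]
    linarith
  intro t h
  refine ⟨hS h, ?_⟩
  have h1 := (hRiccati t h).unique_of_eqOn_Ico h
    ((hlam t h).smul_const (ContinuousLinearMap.id ℝ V)) hS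
  rw [hS h] at h1
  ext v
  have h2 := congrArg (fun A : V →L[ℝ] V => A v) h1
  simp only [sub_apply, neg_apply,
    ContinuousLinearMap.comp_apply, smul_apply,
    ContinuousLinearMap.id_apply, map_smul] at h2
  simp only [smul_apply, ContinuousLinearMap.id_apply]
  rw [sub_eq_iff_eq_add, ← sub_eq_iff_eq_add'] at h2
  rw [← h2]
  module
end

section
/- Let Λ be a Lagrangian subspace of abstract Jacobi fields on a finite-dimensional real inner product space V. Then for every t ∈ ℝ, the subspace {J(t) : J ∈ Λ} of V is exactly the orthogonal complement of the subspace {K'(t) : K ∈ Λ, K(t) = 0}. -/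
open RealInnerProductSpace

variable {V : Type*} [NormedAddCommGroup V] [InnerProductSpace ℝ V]

/-- `J : ℝ → V` is an abstract Jacobi field for the curvature family `R`. -/
def IsJacobiField (R : ℝ → V →L[ℝ] V) (J : ℝ → V) : Prop :=
  ContDiff ℝ (⊤ : ℕ∞) J ∧ ∀ t : ℝ, deriv (deriv J) t = -(R t (J t))

/-- A Lagrangian subspace of abstract Jacobi fields: a subspace of the space of
Jacobi fields for `R` of dimension `dim V` on which the Wronskian vanishes. -/
def IsLagrangian [FiniteDimensional ℝ V] (R : ℝ → V →L[ℝ] V)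
    (Λ : Submodule ℝ (ℝ → V)) : Prop :=
  (∀ J ∈ Λ, IsJacobiField R J) ∧
    Module.finrank ℝ Λ = Module.finrank ℝ V ∧
    ∀ J₁ ∈ Λ, ∀ J₂ ∈ Λ, ∀ t : ℝ, ⟪deriv J₁ t, J₂ t⟫ = ⟪J₁ t, deriv J₂ t⟫

/-- A solution of a linear ODE with continuous coefficients that vanishes at one time
vanishes identically. -/
theorem eq_zero_of_linear_ode {E : Type*} [NormedAddCommGroup E] [NormedSpace ℝ E]
    {A : ℝ → E →L[ℝ] E} (hA : Continuous A) {u : ℝ → E}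
    (hu : ∀ s, HasDerivAt u (A s (u s)) s) {t : ℝ} (ht : u t = 0) : u = 0 := by
  funext s
  obtain ⟨a, ha⟩ := exists_lt (min s t)
  obtain ⟨b, hb⟩ := exists_gt (max s t)
  rw [lt_min_iff] at ha
  rw [max_lt_iff] at hb
  obtain ⟨C, hC⟩ := (isCompact_Icc (a := a) (b := b)).exists_bound_of_continuousOn hA.continuousOn
  refine ODE_solution_unique_of_mem_Ioo (v := fun r x => A r x) (s := fun _ => Set.univ)
    (K := C.toNNReal) (f := u) (g := 0) ?_ (t₀ := t) ⟨ha.2, hb.2⟩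
    (fun r _ => ⟨hu r, Set.mem_univ _⟩) (fun r _ => ⟨?_, Set.mem_univ _⟩) ht ⟨ha.1, hb.1⟩
  · intro r hr
    refine ((A r).lipschitz.weaken ?_).lipschitzOnWith
    exact NNReal.le_toNNReal_of_coe_le (hC r (Set.Ioo_subset_Icc_self hr))
  · simp

theorem IsJacobiField.differentiable {R : ℝ → V →L[ℝ] V} {J : ℝ → V}
    (hJ : IsJacobiField R J) : Differentiable ℝ J :=
  hJ.1.differentiable (by simp)

theorem IsJacobiField.differentiable_deriv {R : ℝ → V →L[ℝ] V} {J : ℝ → V}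
    (hJ : IsJacobiField R J) : Differentiable ℝ (deriv J) :=
  (contDiff_infty_iff_deriv.1 hJ.1).2.differentiable (by simp)

/-- A Jacobi field is determined by its value and derivative at one time. -/
theorem IsJacobiField.eq_zero {R : ℝ → V →L[ℝ] V} (hR : Continuous R) {J : ℝ → V}
    (hJ : IsJacobiField R J) {t : ℝ} (h₀ : J t = 0) (h₁ : deriv J t = 0) : J = 0 := by
  have h := eq_zero_of_linear_ode (E := V × V) (u := fun s => (J s, deriv J s)) (t := t)
    (A := fun s => (ContinuousLinearMap.snd ℝ V V).prod
      (-((R s).comp (ContinuousLinearMap.fst ℝ V V)))) ?_ ?_ (by simp [h₀, h₁])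
  · funext s
    exact congrArg Prod.fst (congrFun h s)
  · have hc : Continuous fun s => -((R s).comp (ContinuousLinearMap.fst ℝ V V)) :=
      (hR.clm_comp continuous_const).neg
    exact (ContinuousLinearMap.prodₗᵢ (𝕜 := ℝ) (E := V × V) (F := V) (G := V) ℝ).continuous.comp
      (continuous_const.prodMk hc)
  · intro s
    refine (hJ.differentiable s).hasDerivAt.prodMk ?_
    simpa [hJ.2 s] using (hJ.differentiable_deriv s).hasDerivAt

/-- The derivative at `t`, as a linear map on a space of differentiable curves. -/
noncomputable def derivAt (Λ : Submodule ℝ (ℝ → V)) (hΛ : ∀ J ∈ Λ, Differentiable ℝ J) (t : ℝ) :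
    Λ →ₗ[ℝ] V where
  toFun J := deriv (J : ℝ → V) t
  map_add' J K := deriv_add (hΛ J J.2 t) (hΛ K K.2 t)
  map_smul' c J := deriv_const_smul c (hΛ J J.2 t)

/-- If `e, d : L → V` are jointly injective linear maps with `dim L = dim V` and `⟪d x, e y⟫`
symmetric, then the range of `e` is the orthogonal complement of `d (ker e)`. -/
theorem LinearMap.range_eq_orthogonal_map_ker [FiniteDimensional ℝ V]
    {L : Type*} [AddCommGroup L] [Module ℝ L] (e d : L →ₗ[ℝ] V)
    (hinj : ∀ x, e x = 0 → d x = 0 → x = 0)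
    (hdim : Module.finrank ℝ L = Module.finrank ℝ V)
    (hsymm : ∀ x y, ⟪d x, e y⟫ = ⟪e x, d y⟫) :
    LinearMap.range e = ((LinearMap.ker e).map d)ᗮ := by
  have hprod : Function.Injective (e.prod d) := by
    rw [injective_iff_map_eq_zero]
    intro x hx
    exact hinj x (congrArg Prod.fst hx) (congrArg Prod.snd hx)
  have : FiniteDimensional ℝ L := Module.Finite.of_injective _ hprod
  refine Submodule.eq_of_le_of_finrank_eq ?_ ?_
  · rintro _ ⟨y, rfl⟩
    rw [Submodule.mem_orthogonal]
    rintro _ ⟨x, hx, rfl⟩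
    rw [hsymm, LinearMap.mem_ker.1 hx, inner_zero_left]
  · have hker : Module.finrank ℝ ((LinearMap.ker e).map d) =
        Module.finrank ℝ (LinearMap.ker e) := by
      rw [← LinearMap.range_domRestrict]
      refine LinearMap.finrank_range_of_inj ?_
      rw [injective_iff_map_eq_zero]
      rintro ⟨x, hx⟩ h
      exact Subtype.ext (hinj x hx h)
    have h₁ := e.finrank_range_add_finrank_ker
    have h₂ := ((LinearMap.ker e).map d).finrank_add_finrank_orthogonal
    omega

/-- **Image of evaluation.** For a Lagrangian subspace `Λ` of abstract Jacobi
fields, for every `t` the subspace `{J(t) : J ∈ Λ}` is exactly the orthogonal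
complement of `{K'(t) : K ∈ Λ, K(t) = 0}`. -/
theorem eval_image_eq_orthogonal_of_kernel_derivs
    [FiniteDimensional ℝ V]
    (R : ℝ → V →L[ℝ] V)
    (hR_smooth : ContDiff ℝ (⊤ : ℕ∞) R)
    (hR_sym : ∀ t : ℝ, ∀ x y : V, ⟪R t x, y⟫ = ⟪x, R t y⟫)
    (Λ : Submodule ℝ (ℝ → V)) (hΛ : IsLagrangian R Λ) (t : ℝ) :
    {x : V | ∃ J ∈ Λ, J t = x} =
      ↑((Submodule.span ℝ {x : V | ∃ K ∈ Λ, K t = 0 ∧ deriv K t = x})ᗮ) := by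
  have hdiff : ∀ J ∈ Λ, Differentiable ℝ J := fun J hJ => (hΛ.1 J hJ).differentiable
  have h := LinearMap.range_eq_orthogonal_map_ker ((LinearMap.proj t).comp Λ.subtype)
    (derivAt Λ hdiff t)
    (fun J h₀ h₁ => Subtype.ext ((hΛ.1 J J.2).eq_zero hR_smooth.continuous h₀ h₁))
    hΛ.2.1 (fun J K => hΛ.2.2 J J.2 K K.2 t)
  have himage : {x : V | ∃ K ∈ Λ, K t = 0 ∧ deriv K t = x} =
      (LinearMap.ker ((LinearMap.proj t).comp Λ.subtype)).map (derivAt Λ hdiff t) := by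
    ext x
    simp [derivAt, and_left_comm]
  rw [himage, Submodule.span_eq, ← h]
  ext x
  simp
end

section
/- Let Λ be a Lagrangian subspace of abstract Jacobi fields on a finite-dimensional real inner product space V, let 𝒱 ⊆ Λ be a subspace having full index at some t ∈ ℝ, and let H(t) denote the orthogonal complement of 𝒱(t) in V. Then for every x ∈ H(t) there exists J ∈ Λ with J(t) = x. -/
open RealInnerProductSpace

variable {V : Type*} [NormedAddCommGroup V] [InnerProductSpace ℝ V]

/-- `𝒲(t) = {J(t) : J ∈ 𝒲} + {J'(t) : J ∈ 𝒲, J(t) = 0}`. -/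
def evalSp (𝒲 : Submodule ℝ (ℝ → V)) (t : ℝ) : Submodule ℝ V :=
  Submodule.span ℝ
    ({x : V | ∃ J ∈ 𝒲, J t = x} ∪ {x : V | ∃ J ∈ 𝒲, J t = 0 ∧ deriv J t = x})

/-- **Surjectivity onto the horizontal space.** If `𝒱 ⊆ Λ` has full index at `t`
and `H(t) = 𝒱(t)ᗮ`, then every `x ∈ H(t)` is of the form `J(t)` for some `J ∈ Λ`. -/
theorem exists_jacobi_eval_eq_of_mem_horizontal
    [FiniteDimensional ℝ V]
    (R : ℝ → V →L[ℝ] V)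
    (hR_smooth : ContDiff ℝ (⊤ : ℕ∞) R)
    (hR_sym : ∀ t : ℝ, ∀ x y : V, ⟪R t x, y⟫ = ⟪x, R t y⟫)
    (Λ : Submodule ℝ (ℝ → V)) (hΛ : IsLagrangian R Λ)
    (𝒱 : Submodule ℝ (ℝ → V)) (h𝒱Λ : 𝒱 ≤ Λ)
    (t : ℝ)
    (hfull : ∀ J ∈ Λ, J t = 0 → J ∈ 𝒱) :
    ∀ x ∈ (evalSp 𝒱 t)ᗮ, ∃ J ∈ Λ, J t = x := by
  obtain ⟨hJac, hdim, hsymp⟩ := hΛ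
  have hdiff : ∀ J : Λ, DifferentiableAt ℝ (J : ℝ → V) t := fun J =>
    (hJac J J.2).1.differentiable (by simp) t
  let ev : Λ →ₗ[ℝ] V := (LinearMap.proj t).comp Λ.subtype
  let dv : Λ →ₗ[ℝ] V :=
    { toFun := fun J => deriv (J : ℝ → V) t
      map_add' := fun J K => deriv_add (hdiff J) (hdiff K)
      map_smul' := fun c J => deriv_const_smul c (hdiff J) }
  have hzero : ∀ J : Λ, ev J = 0 → dv J = 0 → J = 0 := fun J h₀ h₁ =>
    Subtype.ext ((hJac J J.2).eq_zero hR_smooth.continuous h₀ h₁)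
  have : FiniteDimensional ℝ Λ := by
    refine Module.Finite.of_injective (ev.prod dv) ((injective_iff_map_eq_zero _).2 fun J hJ => ?_)
    exact hzero J (congrArg Prod.fst hJ) (congrArg Prod.snd hJ)
  let D : LinearMap.ker ev →ₗ[ℝ] V := dv.comp (LinearMap.ker ev).subtype
  have hD : Function.Injective D :=
    (injective_iff_map_eq_zero _).2 fun J hJ => Subtype.ext (hzero J J.2 hJ)
  have hle : LinearMap.range D ≤ (LinearMap.range ev)ᗮ := by
    rintro _ ⟨J, rfl⟩
    rw [Submodule.mem_orthogonal']
    rintro _ ⟨K, rfl⟩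
    have hJ : (J : ℝ → V) t = 0 := J.2
    have h := hsymp J J.1.2 K K.2 t
    rwa [hJ, inner_zero_left] at h
  have heq : LinearMap.range D = (LinearMap.range ev)ᗮ := by
    refine Submodule.eq_of_le_of_finrank_eq hle ?_
    have h₁ := (LinearMap.range ev).finrank_add_finrank_orthogonal
    have h₂ := ev.finrank_range_add_finrank_ker
    have h₃ := LinearMap.finrank_range_of_inj hD
    omega
  intro x hx
  have hxr : x ∈ LinearMap.range ev := by
    rw [← Submodule.orthogonal_orthogonal (LinearMap.range ev), ← heq, Submodule.mem_orthogonal]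
    rintro _ ⟨J, rfl⟩
    have hJ : (J : ℝ → V) t = 0 := J.2
    exact (Submodule.mem_orthogonal _ _).1 hx _
      (Submodule.subset_span (Or.inr ⟨J, hfull J J.1.2 hJ, hJ, rfl⟩))
  obtain ⟨J, hJ⟩ := hxr
  exact ⟨J, J.2, hJ⟩
end

section
/- Let V be a finite-dimensional real inner product space, κ ∈ ℝ, and let R : ℝ → End(V) be a smooth family of self-adjoint endomorphisms satisfying the radial intermediate Ricci bound Ric_k ≥ k·κ. Let Λ be a Lagrangian subspace of abstract Jacobi fields for R, let t₀ < t_max, and let λ̃ : [t₀, t_max) → ℝ be a solution of the scalar Riccati equation with parameter κ. Let W ⊆ V be a k-dimensional subspace contained in {J(t₀) : J ∈ Λ}, and assume that for some orthonormal basis (e₁, …, e_k) of W and some J₁, …, J_k ∈ Λ with Jᵢ(t₀) = eᵢ one has Σᵢ ⟨Jᵢ'(t₀), eᵢ⟩ ≤ k·λ̃(t₀). Let 𝒱 := {J ∈ Λ : J(t₀) ⊥ W}, assume 𝒱 has full index on [t₀, t_max), and let H(t) denote the orthogonal complement of 𝒱(t) in V. Then for every t ∈ [t₀, t_max), every orthonormal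 basis (x₁, …, x_k) of H(t), and every choice of K₁, …, K_k ∈ Λ with Kᵢ(t) = xᵢ, one has Σᵢ ⟨Kᵢ'(t), xᵢ⟩ ≤ k·λ̃(t). -/
open RealInnerProductSpace

variable {V : Type*} [NormedAddCommGroup V] [InnerProductSpace ℝ V]

/-- Weighted average of `f` over the segment from `a` to `t`. -/
noncomputable def segmentMean (m : ℕ) (a : ℝ) (f : ℝ → V) (t : ℝ) : V :=
  ∫ s in (0 : ℝ)..1, s ^ m • f (a + s * (t - a))

theorem hasDerivAt_segmentMean [CompleteSpace V] (m : ℕ) (a : ℝ) {f f' : ℝ → V}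
    (hf : ∀ t, HasDerivAt f (f' t) t) (hf' : Continuous f') (t : ℝ) :
    HasDerivAt (segmentMean m a f) (segmentMean (m + 1) a f' t) t := by
  have hfc : Continuous f := continuous_iff_continuousAt.2 fun t ↦ (hf t).continuousAt
  have hcont : Continuous fun p : ℝ × ℝ ↦ p.2 ^ (m + 1) • f' (a + p.2 * (p.1 - a)) := by fun_prop
  obtain ⟨C, hC⟩ := ((isCompact_closedBall t 1).prod (isCompact_Icc (a := (0 : ℝ)) (b := 1)))
    |>.exists_bound_of_continuousOn hcont.continuousOn
  refine (intervalIntegral.hasDerivAt_integral_of_dominated_loc_of_deriv_le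
    (F := fun t s ↦ s ^ m • f (a + s * (t - a)))
    (F' := fun t s ↦ s ^ (m + 1) • f' (a + s * (t - a))) (bound := fun _ ↦ C)
    (Metric.closedBall_mem_nhds t one_pos) ?_ ?_ ?_ ?_ ?_ ?_).2
  · exact .of_forall fun x ↦ Continuous.aestronglyMeasurable (by fun_prop)
  · exact Continuous.intervalIntegrable (by fun_prop) _ _
  · exact Continuous.aestronglyMeasurable (by fun_prop)
  · refine .of_forall fun s hs x hx ↦ ?_
    rw [Set.uIoc_of_le zero_le_one] at hs
    exact hC (x, s) ⟨hx, hs.1.le, hs.2⟩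
  · exact intervalIntegrable_const
  · refine .of_forall fun s _ x _ ↦ ?_
    have h1 : HasDerivAt (fun x ↦ a + s * (x - a)) s x := by
      simpa using (((hasDerivAt_id x).sub_const a).const_mul s).const_add a
    have h2 := ((hf _).scomp x h1).const_smul (s ^ m)
    simpa [pow_succ, mul_smul, Function.comp_def, Pi.smul_def] using h2

theorem contDiff_segmentMean [CompleteSpace V] (n : ℕ) (m : ℕ) (a : ℝ) {f : ℝ → V}
    (hf : ContDiff ℝ (⊤ : ℕ∞) f) : ContDiff ℝ n (segmentMean m a f) := by
  have key : ∀ {f : ℝ → V}, ContDiff ℝ (⊤ : ℕ∞) f → ∀ m t,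
      HasDerivAt (segmentMean m a f) (segmentMean (m + 1) a (deriv f) t) t := fun hf m ↦
    hasDerivAt_segmentMean m a
      (fun t ↦ (hf.differentiable (by simp) t).hasDerivAt) (hf.continuous_deriv (by simp))
  induction n generalizing m f with
  | zero =>
    exact contDiff_zero.2 (continuous_iff_continuousAt.2 fun t ↦ (key hf m t).continuousAt)
  | succ n ih =>
    push_cast
    refine contDiff_succ_iff_deriv.2 ⟨fun t ↦ (key hf m t).differentiableAt, by simp, ?_⟩
    rw [show deriv (segmentMean m a f) = segmentMean (m + 1) a (deriv f) from
      funext fun t ↦ (key hf m t).deriv]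
    exact ih (m + 1) (contDiff_infty_iff_deriv.1 hf).2

theorem smul_segmentMean_deriv [CompleteSpace V] (a : ℝ) {f : ℝ → V}
    (hf : ContDiff ℝ (⊤ : ℕ∞) f) (ha : f a = 0) (t : ℝ) :
    (t - a) • segmentMean 0 a (deriv f) t = f t := by
  have hd : ∀ s ∈ Set.uIcc (0 : ℝ) 1,
      HasDerivAt (fun s ↦ f (a + s * (t - a))) ((t - a) • deriv f (a + s * (t - a))) s := by
    intro s _
    have h1 : HasDerivAt (fun s ↦ a + s * (t - a)) (t - a) s := by
      simpa using ((hasDerivAt_id s).mul_const (t - a)).const_add a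
    exact ((hf.differentiable (by simp) _).hasDerivAt).scomp s h1
  have hc : Continuous (deriv f) := hf.continuous_deriv (by simp)
  have := intervalIntegral.integral_eq_sub_of_hasDerivAt hd
    (Continuous.intervalIntegrable (by fun_prop) _ _)
  simpa [segmentMean, ha] using this

theorem segmentMean_self (a : ℝ) (f : ℝ → V) [CompleteSpace V] : segmentMean 0 a f a = f a := by
  simp [segmentMean]

theorem jacobi_hasDerivAt {R : ℝ → V →L[ℝ] V} {X : ℝ → V} (hX : IsJacobiField R X) (t : ℝ) :
    HasDerivAt X (deriv X t) t :=
  (hX.1.differentiable (by simp) t).hasDerivAt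

theorem jacobi_hasDerivAt_deriv {R : ℝ → V →L[ℝ] V} {X : ℝ → V} (hX : IsJacobiField R X) (t : ℝ) :
    HasDerivAt (deriv X) (-(R t (X t))) t :=
  hX.2 t ▸ (((contDiff_infty_iff_deriv.1 hX.1).2).differentiable (by simp) t).hasDerivAt

theorem jacobi_eq_zero {R : ℝ → V →L[ℝ] V} (hR : Continuous R) {X : ℝ → V}
    (hX : IsJacobiField R X) {a : ℝ} (h0 : X a = 0) (h1 : deriv X a = 0) : X = 0 := by
  funext t
  obtain ⟨C, hC⟩ := (isCompact_Icc (a := min a t - 1) (b := max a t + 1)).exists_bound_of_continuousOn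
    hR.continuousOn
  set v : ℝ → V × V → V × V := fun s p ↦ (p.2, -(R s p.1))
  have hv : ∀ s ∈ Set.Ioo (min a t - 1) (max a t + 1),
      LipschitzOnWith (Real.toNNReal (max 1 C)) (v s) Set.univ := by
    intro s hs
    refine LipschitzOnWith.of_dist_le_mul fun p _ q _ ↦ ?_
    have h3 : ‖R s‖ ≤ C := hC s ⟨hs.1.le, hs.2.le⟩
    have h4 : ‖R s p.1 - R s q.1‖ ≤ C * ‖p.1 - q.1‖ := by
      rw [← map_sub]; exact (R s).le_of_opNorm_le h3 _
    rw [Real.coe_toNNReal _ (zero_le_one.trans (le_max_left _ _)), dist_eq_norm, dist_eq_norm,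
      Prod.norm_def]
    have h5 : ‖p.1 - q.1‖ ≤ ‖p - q‖ := norm_fst_le (p - q)
    have h6 : ‖p.2 - q.2‖ ≤ ‖p - q‖ := norm_snd_le (p - q)
    refine max_le ?_ ?_
    · calc ‖p.2 - q.2‖ ≤ 1 * ‖p - q‖ := by rwa [one_mul]
        _ ≤ _ := by gcongr; exact le_max_left _ _
    · calc ‖-(R s p.1) - -(R s q.1)‖ = ‖R s p.1 - R s q.1‖ := by
            rw [neg_sub_neg, norm_sub_rev]
        _ ≤ C * ‖p.1 - q.1‖ := h4
        _ ≤ max 1 C * ‖p - q‖ := by gcongr; exact le_max_right _ _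
  have hmem : ∀ s, s = a ∨ s = t → s ∈ Set.Ioo (min a t - 1) (max a t + 1) := by
    rintro s (rfl | rfl)
    · exact ⟨by linarith [min_le_left s t], by linarith [le_max_left s t]⟩
    · exact ⟨by linarith [min_le_right a s], by linarith [le_max_right a s]⟩
  have := ODE_solution_unique_of_mem_Ioo (f := fun s ↦ (X s, deriv X s)) (g := fun _ ↦ 0)
    hv (hmem a (.inl rfl))
    (fun s _ ↦ ⟨(jacobi_hasDerivAt hX s).prodMk (jacobi_hasDerivAt_deriv hX s), Set.mem_univ _⟩)
    (fun s _ ↦ ⟨by convert hasDerivAt_const s (0 : V × V) using 1; simp [v], Set.mem_univ _⟩)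
    (by simp [h0, h1]) (hmem t (.inr rfl))
  exact (Prod.ext_iff.1 this).1

/-- Dividing the fields vanishing at `a` by `t - a` turns evaluation at `t` of a Lagrangian
subspace into a family `A` of endomorphisms that is `C²` and invertible near `a`. -/
theorem exists_desingularization [FiniteDimensional ℝ V] {R : ℝ → V →L[ℝ] V} (hR : Continuous R)
    {Λ : Submodule ℝ (ℝ → V)} (hΛ : IsLagrangian R Λ) (a : ℝ) :
    ∃ (A : ℝ → V →L[ℝ] V) (φ : V ≃ₗ[ℝ] Λ) (π : Λ →ₗ[ℝ] Λ),
      ContDiff ℝ 2 A ∧ A a = 1 ∧ (∀ X : Λ, (π X : ℝ → V) a = 0) ∧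
      (∀ X : Λ, (X : ℝ → V) a = 0 → π X = X) ∧
      (∀ X : Λ, φ.symm X = deriv (π X : ℝ → V) a + (X - π X : ℝ → V) a) ∧
      ∀ t v, (t - a) • A t v = (π (φ v) : ℝ → V) t + (t - a) • (φ v - π (φ v) : ℝ → V) t := by
  obtain ⟨hJ, hdim, hW⟩ := hΛ
  let Z : Submodule ℝ Λ :=
    LinearMap.ker ((LinearMap.proj a : (ℝ → V) →ₗ[ℝ] V) ∘ₗ Λ.subtype)
  have hZ : ∀ X : Λ, X ∈ Z ↔ (X : ℝ → V) a = 0 := fun X ↦ by simp [Z]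
  obtain ⟨Q, hQ⟩ := Z.exists_isCompl
  let π : Λ →ₗ[ℝ] Λ := Submodule.projection Z Q hQ
  have hπ0 : ∀ X : Λ, (π X : ℝ → V) a = 0 :=
    fun X ↦ (hZ _).1 (Submodule.projection_apply_mem hQ X)
  have hπ1 : ∀ X : Λ, (X : ℝ → V) a = 0 → π X = X :=
    fun X hX ↦ Submodule.projection_apply_left hQ ⟨X, (hZ X).2 hX⟩
  have hderiv : ∀ (X : Λ) t, HasDerivAt (X : ℝ → V) (deriv (X : ℝ → V) t) t :=
    fun X t ↦ jacobi_hasDerivAt (hJ X X.2) t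
  have hcd : ∀ X : Λ, Continuous (deriv (X : ℝ → V)) :=
    fun X ↦ (hJ X X.2).1.continuous_deriv (by simp)
  have hadd : ∀ X Y : Λ, deriv ((X + Y : Λ) : ℝ → V) = deriv (X : ℝ → V) + deriv (Y : ℝ → V) :=
    fun X Y ↦ funext fun t ↦ ((hderiv X t).add (hderiv Y t)).deriv
  have hsmul : ∀ (c : ℝ) (X : Λ), deriv ((c • X : Λ) : ℝ → V) = c • deriv (X : ℝ → V) :=
    fun c X ↦ funext fun t ↦ ((hderiv X t).const_smul c).deriv
  let E (t : ℝ) : Λ →ₗ[ℝ] V :=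
    { toFun := fun X ↦ segmentMean 0 a (deriv (π X : ℝ → V)) t + (X - π X : ℝ → V) t
      map_add' := fun X Y ↦ by
        have h1 : segmentMean 0 a (deriv (π (X + Y) : ℝ → V)) t =
            segmentMean 0 a (deriv (π X : ℝ → V)) t + segmentMean 0 a (deriv (π Y : ℝ → V)) t := by
          have hX := hcd (π X)
          have hY := hcd (π Y)
          simp only [segmentMean, map_add, hadd]
          rw [← intervalIntegral.integral_add (Continuous.intervalIntegrable (by fun_prop) _ _)
            (Continuous.intervalIntegrable (by fun_prop) _ _)]
          simp
        rw [h1]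
        simp only [map_add, Submodule.coe_add, Pi.sub_apply, Pi.add_apply]
        abel
      map_smul' := fun c X ↦ by
        have h1 : segmentMean 0 a (deriv (π (c • X) : ℝ → V)) t =
            c • segmentMean 0 a (deriv (π X : ℝ → V)) t := by
          simp only [segmentMean, map_smul, hsmul]
          rw [← intervalIntegral.integral_smul]
          simp
        rw [h1]
        simp [smul_sub] }
  have hEa : ∀ X, E a X = deriv (π X : ℝ → V) a + (X - π X : ℝ → V) a := fun X ↦ by
    simp [E, segmentMean_self]
  have hinj : Function.Injective (E a) := by
    rw [← LinearMap.ker_eq_bot, LinearMap.ker_eq_bot']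
    intro X hX
    rw [hEa] at hX
    have horth : inner ℝ (deriv (π X : ℝ → V) a) ((X - π X : ℝ → V) a) = 0 := by
      have := hW _ (π X).2 _ (X - π X).2 a
      simpa [hπ0 X] using this
    have h1 : deriv (π X : ℝ → V) a = 0 := by
      rw [← inner_self_eq_zero (𝕜 := ℝ)]
      have := congrArg (inner ℝ (deriv (π X : ℝ → V) a)) hX
      rwa [inner_add_right, horth, add_zero, inner_zero_right] at this
    have h2 : (X : ℝ → V) a = 0 := by simpa [h1, hπ0 X] using hX
    rw [← hπ1 X h2]
    exact Subtype.ext (jacobi_eq_zero hR (hJ _ (π X).2) (hπ0 X) h1)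
  have : FiniteDimensional ℝ Λ := FiniteDimensional.of_injective (E a) hinj
  let φ : V ≃ₗ[ℝ] Λ := ((E a).linearEquivOfInjective hinj hdim).symm
  have hφ : ∀ X, φ.symm X = E a X := fun X ↦ by simp [φ]
  refine ⟨fun t ↦ LinearMap.toContinuousLinearMap (E t ∘ₗ φ.toLinearMap), φ, π, ?_, ?_, hπ0, hπ1,
    fun X ↦ (hφ X).trans (hEa X), ?_⟩
  · refine contDiff_clm_apply_iff.2 fun v ↦ ?_
    refine (contDiff_segmentMean 2 0 a (contDiff_infty_iff_deriv.1 (hJ _ (π (φ v)).2).1).2).add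
      (contDiff_infty.1 (hJ _ (φ v - π (φ v)).2).1 2)
  · ext v
    simpa using (hφ (φ v)).symm
  · intro t v
    have := smul_segmentMean_deriv a (hJ _ (π (φ v)).2).1 (hπ0 _) t
    simp [E, smul_add, this]

/-- The desingularization adapted to a subspace `𝒱` of full index at `a`. -/
theorem exists_adapted_desingularization [FiniteDimensional ℝ V] {R : ℝ → V →L[ℝ] V}
    (hR : Continuous R) {Λ 𝒱 : Submodule ℝ (ℝ → V)} (hΛ : IsLagrangian R Λ) (h𝒱Λ : 𝒱 ≤ Λ) {a : ℝ}
    (hfull : ∀ X ∈ Λ, X a = 0 → X ∈ 𝒱) :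
    ∃ (A : ℝ → V →L[ℝ] V) (φ : V ≃ₗ[ℝ] Λ), ContDiff ℝ 2 A ∧ A a = 1 ∧
      (∀ h ∈ (evalSp 𝒱 a)ᗮ, (φ h : ℝ → V) a = h) ∧
      (∀ X : Λ, φ.symm X ∈ evalSp 𝒱 a ↔ (X : ℝ → V) ∈ 𝒱) ∧
      (∀ t, IsUnit (A t) → t ≠ a → ∀ X ∈ Λ, X t = 0 → X = 0) ∧
      (∀ t, ∀ X : Λ, ∃ w, A t w = (X : ℝ → V) t ∧
        ∀ h ∈ (evalSp 𝒱 a)ᗮ, ⟪h, w⟫ = ⟪h, φ.symm X⟫) ∧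
      ∀ d, (∀ U ∈ Λ, ⟪d, U a⟫ = 0) → ∃ U ∈ Λ, U a = 0 ∧ deriv U a = d := by
  obtain ⟨A, φ, π, hA, hA1, hπ0, hπ1, hφ, hAt⟩ := exists_desingularization hR hΛ a
  have horth : ∀ X : Λ, ⟪deriv (π X : ℝ → V) a, (X - π X : ℝ → V) a⟫ = 0 := fun X ↦ by
    have := hΛ.2.2 _ (π X).2 _ (X - π X).2 a
    simpa [hπ0 X] using this
  have hπV : ∀ X : Λ, (π X : ℝ → V) ∈ 𝒱 := fun X ↦ hfull _ (π X).2 (hπ0 X)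
  have hderiv_mem : ∀ X : Λ, deriv (π X : ℝ → V) a ∈ evalSp 𝒱 a := fun X ↦
    Submodule.subset_span (.inr ⟨_, hπV X, hπ0 X, rfl⟩)
  have hππ : ∀ X, π (π X) = π X := fun X ↦ hπ1 _ (hπ0 X)
  have hφπ : ∀ X, φ.symm (π X) = deriv (π X : ℝ → V) a := fun X ↦ by
    rw [hφ, hππ]; simp
  have hfactor : ∀ t, ∀ X : Λ, A t (φ.symm ((t - a) • π X + (X - π X))) = (X : ℝ → V) t := by
    intro t X
    rcases eq_or_ne t a with rfl | hta
    · rw [hA1, sub_self, zero_smul, zero_add, hφ]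
      simp [hππ, hπ0]
    · have h1 := hAt t (φ.symm ((t - a) • π X + (X - π X)))
      have h2 : π ((t - a) • π X + (X - π X)) = (t - a) • π X := by simp [hππ]
      rw [LinearEquiv.apply_symm_apply, h2] at h1
      refine smul_right_injective V (sub_ne_zero.2 hta) (h1.trans ?_)
      simp [← smul_add]
  refine ⟨A, φ, hA, hA1, fun h hh ↦ ?_, fun X ↦ ⟨fun hX ↦ ?_, fun hX ↦ ?_⟩,
    fun t hu hta X hX hXt ↦ ?_, fun t X ↦ ⟨_, hfactor t X, fun h hh ↦ ?_⟩, fun d hd ↦ ?_⟩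
  · have h1 := hφ (φ h)
    rw [LinearEquiv.symm_apply_apply] at h1
    have h2 : ⟪h, deriv (π (φ h) : ℝ → V) a⟫ = 0 :=
      Submodule.inner_left_of_mem_orthogonal (hderiv_mem _) hh
    have h3 : deriv (π (φ h) : ℝ → V) a = 0 := by
      rw [← inner_self_eq_zero (𝕜 := ℝ)]
      nth_rw 1 [h1] at h2
      rwa [inner_add_left, real_inner_comm _ ((φ h - π (φ h) : ℝ → V) a), horth, add_zero] at h2
    rw [h3] at h1
    simpa [hπ0] using h1.symm
  · suffices h : evalSp 𝒱 a ≤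
        (𝒱.comap (Λ.subtype ∘ₗ φ.toLinearMap)) by simpa using h hX
    refine Submodule.span_le.2 ?_
    rintro _ (⟨Y, hY, rfl⟩ | ⟨Y, hY, hY0, rfl⟩)
    · let Y' : Λ := ⟨Y, h𝒱Λ hY⟩
      have h1 : φ (Y a) = Y' - π Y' := by
        rw [← LinearEquiv.eq_symm_apply, hφ]
        simp [hππ, hπ0, Y']
      simpa [h1] using 𝒱.sub_mem hY (hπV Y')
    · let Y' : Λ := ⟨Y, h𝒱Λ hY⟩
      have h1 : φ (deriv Y a) = Y' := by
        rw [← LinearEquiv.eq_symm_apply, hφ, hπ1 Y' hY0]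
        simp [Y']
      simpa [h1] using hY
  · rw [hφ]
    exact add_mem (hderiv_mem X)
      (Submodule.subset_span (.inl ⟨_, 𝒱.sub_mem hX (hπV X), rfl⟩))
  · obtain ⟨B, hB⟩ := hu
    have h1 := hfactor t ⟨X, hX⟩
    have h2 : φ.symm ((t - a) • π ⟨X, hX⟩ + (⟨X, hX⟩ - π ⟨X, hX⟩)) = 0 := by
      have := congrArg (B⁻¹ : (V →L[ℝ] V)ˣ).val (h1.trans hXt)
      rwa [← hB, ← mul_apply_eq_comp, Units.inv_mul, map_zero] at this
    rw [LinearEquiv.map_eq_zero_iff] at h2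
    have h3 := congrArg π h2
    have h4 : π ⟨X, hX⟩ = 0 := by simpa [hππ, sub_ne_zero.2 hta] using h3
    rw [h4] at h2
    simpa using h2
  · have h1 : ⟪h, φ.symm (π X)⟫ = 0 := by
      rw [hφπ]; exact Submodule.inner_left_of_mem_orthogonal (hderiv_mem _) hh
    simp [inner_add_right, inner_sub_right, inner_smul_right, h1]
  · have h1 := hφ (φ d)
    rw [LinearEquiv.symm_apply_apply] at h1
    refine ⟨π (φ d), (π (φ d)).2, hπ0 _, ?_⟩
    have h2 : (φ d - π (φ d) : ℝ → V) a = 0 := by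
      rw [← inner_self_eq_zero (𝕜 := ℝ)]
      have : ⟪d, (φ d - π (φ d) : ℝ → V) a⟫ = 0 := hd _ (φ d - π (φ d)).2
      nth_rw 1 [h1] at this
      rwa [inner_add_left, horth, zero_add] at this
    rw [h2, add_zero] at h1
    exact h1.symm

open Topology in
theorem exists_inverse_adjoint [FiniteDimensional ℝ V] {A : ℝ → V →L[ℝ] V} {a : ℝ}
    (hA : ContDiff ℝ 2 A) (hA1 : A a = 1) :
    ∃ C : ℝ → V →L[ℝ] V, ContDiffAt ℝ 2 C a ∧ C a = 1 ∧
      ∀ᶠ t in 𝓝 a, IsUnit (A t) ∧ ∀ h v, ⟪C t h, A t v⟫ = ⟪h, v⟫ := by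
  let adj : (V →L[ℝ] V) →ₗ[ℝ] (V →L[ℝ] V) :=
    { toFun := ContinuousLinearMap.adjoint
      map_add' := map_add _
      map_smul' := fun c B ↦ by simp }
  have hinv : ContDiffAt ℝ 2 (fun t ↦ Ring.inverse (A t)) a := by
    refine ContDiffAt.comp (g := Ring.inverse) a ?_ hA.contDiffAt
    rw [hA1]
    exact contDiffAt_ringInverse ℝ 1
  refine ⟨fun t ↦ adj (Ring.inverse (A t)), ?_, ?_, ?_⟩
  · exact (LinearMap.toContinuousLinearMap adj).contDiff.contDiffAt.comp a hinv
  · simp only [hA1, Ring.inverse_one]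
    exact ContinuousLinearMap.adjoint_id
  · have hu : ∀ᶠ t in 𝓝 a, IsUnit (A t) :=
      hA.continuous.continuousAt (Units.isOpen.mem_nhds (by rw [hA1]; exact isUnit_one))
    filter_upwards [hu] with t ht
    refine ⟨ht, fun h v ↦ ?_⟩
    change ⟪ContinuousLinearMap.adjoint (Ring.inverse (A t)) h, A t v⟫ = _
    rw [ContinuousLinearMap.adjoint_inner_left, ← mul_apply_eq_comp,
      Ring.inverse_mul_cancel _ ht]
    rfl

theorem sum_inner_smul_eq_of_mem_span {k : ℕ} {y : Fin k → V} (hy : Orthonormal ℝ y) {v : V}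
    (hv : v ∈ Submodule.span ℝ (Set.range y)) : ∑ j, ⟪y j, v⟫ • y j = v := by
  obtain ⟨c, rfl⟩ := (Submodule.mem_span_range_iff_exists_fun ℝ).1 hv
  exact Finset.sum_congr rfl fun j _ ↦ by rw [hy.inner_right_fintype]

/-- The trace of the Riccati operator on the subspace spanned by `y`, expressed in a fixed
orthonormal frame `x`. -/
theorem sum_inner_eq_frame {k : ℕ} {x y : Fin k → V} (hx : Orthonormal ℝ x)
    (hy : Orthonormal ℝ y) {P : V →L[ℝ] V}
    (hP : ∀ v, P v ∈ Submodule.span ℝ (Set.range x))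
    (hPx : ∀ h ∈ Submodule.span ℝ (Set.range x), ∀ v, ⟪h, v - P v⟫ = 0)
    {A C D F : V →L[ℝ] V} (hCA : ∀ h v, ⟪C h, A v⟫ = ⟪h, v⟫)
    (hF : ∀ v, F v = C (P v) + A (v - P v)) (hFu : IsUnit F)
    (hCy : ∀ h ∈ Submodule.span ℝ (Set.range x), C h ∈ Submodule.span ℝ (Set.range y))
    {m : Fin k → V}
    (hm : ∀ i, ∀ h ∈ Submodule.span ℝ (Set.range x), ⟪m i, C h⟫ = -⟪y i, D h⟫) :
    ∑ i, ⟪m i, y i⟫ = -∑ i, ⟪x i, Ring.inverse F (D (x i))⟫ := by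
  set H := Submodule.span ℝ (Set.range x)
  have hinj : Function.Injective C := by
    refine (injective_iff_map_eq_zero C).2 fun h hh ↦ ext_inner_right ℝ fun v ↦ ?_
    rw [← hCA, hh, inner_zero_left, inner_zero_left]
  have hfin : Module.finrank ℝ (Submodule.map C.toLinearMap H) =
      Module.finrank ℝ (Submodule.span ℝ (Set.range y)) := by
    rw [← (Submodule.equivMapOfInjective C.toLinearMap hinj H).finrank_eq,
      finrank_span_eq_card hx.linearIndependent, finrank_span_eq_card hy.linearIndependent]
  have := FiniteDimensional.span_of_finite ℝ (Set.finite_range y)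
  have hmap : Submodule.map C.toLinearMap H = Submodule.span ℝ (Set.range y) :=
    Submodule.eq_of_le_of_finrank_eq (Submodule.map_le_iff_le_comap.2 hCy) hfin
  have hsurj : ∀ j, ∃ h ∈ H, C h = y j := fun j ↦ by
    have : y j ∈ Submodule.map C.toLinearMap H := hmap ▸ Submodule.subset_span ⟨j, rfl⟩
    simpa using this
  choose h hhH hh using hsurj
  have hproj : ∀ v, P (Ring.inverse F v) = ∑ j, ⟪y j, v⟫ • h j := by
    intro v
    obtain ⟨u, rfl⟩ : ∃ u, F u = v :=
      ⟨Ring.inverse F v, by rw [← mul_apply_eq_comp, Ring.mul_inverse_cancel _ hFu]; rfl⟩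
    have h1 : Ring.inverse F (F u) = u := by
      rw [← mul_apply_eq_comp, Ring.inverse_mul_cancel _ hFu]; rfl
    have h2 : ∀ j, ⟪y j, F u⟫ = ⟪y j, C (P u)⟫ := fun j ↦ by
      rw [hF, inner_add_right, add_eq_left, ← hh j, hCA]
      exact hPx _ (hhH j) u
    rw [h1]
    refine hinj ?_
    simp only [h2, map_sum, map_smul, hh]
    exact (sum_inner_smul_eq_of_mem_span hy (hCy _ (hP u))).symm
  have hinner : ∀ i v, ⟪x i, v⟫ = ⟪x i, P v⟫ := fun i v ↦ by
    have := hPx _ (Submodule.subset_span ⟨i, rfl⟩) v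
    rwa [inner_sub_right, sub_eq_zero] at this
  calc ∑ j, ⟪m j, y j⟫ = -∑ j, ⟪y j, D (h j)⟫ := by
        rw [← Finset.sum_neg_distrib]
        exact Finset.sum_congr rfl fun j _ ↦ by rw [← hm j _ (hhH j), hh]
    _ = -∑ j, ⟪y j, D (∑ i, ⟪x i, h j⟫ • x i)⟫ := by
        congr 1
        exact Finset.sum_congr rfl fun j _ ↦ by
          rw [sum_inner_smul_eq_of_mem_span hx (hhH j)]
    _ = -∑ i, ⟪x i, Ring.inverse F (D (x i))⟫ := by
        congr 1
        simp_rw [fun i ↦ hinner i (Ring.inverse F (D (x i))), hproj, map_sum, map_smul,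
          inner_sum, inner_smul_right]
        rw [Finset.sum_comm]
        exact Finset.sum_congr rfl fun i _ ↦ Finset.sum_congr rfl fun j _ ↦ mul_comm _ _

open Topology in
/-- Near a time `a` of full index, the trace of the Riccati operator on `𝒱(t)ᗮ` is given by a
function whose derivative at `a` satisfies the Riccati inequality. -/
theorem exists_local_trace [FiniteDimensional ℝ V] {k : ℕ} {κ : ℝ} {R : ℝ → V →L[ℝ] V}
    (hR : Continuous R)
    {Λ 𝒱 : Submodule ℝ (ℝ → V)} (hΛ : IsLagrangian R Λ) (h𝒱Λ : 𝒱 ≤ Λ) {a : ℝ}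
    (hRic : ∀ e : Fin k → V, Orthonormal ℝ e → (k : ℝ) * κ ≤ ∑ i, ⟪R a (e i), e i⟫)
    (hfull : ∀ X ∈ Λ, X a = 0 → X ∈ 𝒱) {x : Fin k → V} (hx : Orthonormal ℝ x)
    (hspan : Submodule.span ℝ (Set.range x) = (evalSp 𝒱 a)ᗮ) :
    ∃ (g : ℝ → ℝ) (g' : ℝ), HasDerivAt g g' a ∧ k * g' ≤ -(g a) ^ 2 - k * (k * κ) ∧
      ∀ᶠ t in 𝓝 a, ∀ y : Fin k → V, Orthonormal ℝ y →
        Submodule.span ℝ (Set.range y) = (evalSp 𝒱 t)ᗮ →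
        ∀ M : Fin k → ℝ → V, (∀ i, M i ∈ Λ) → (∀ i, M i t = y i) →
          ∑ i, ⟪deriv (M i) t, y i⟫ = g t := by
  obtain ⟨A, φ, hA, hA1, hφH, hφV, hne, hfac, hvan⟩ :=
    exists_adapted_desingularization hR hΛ h𝒱Λ hfull
  obtain ⟨C, hC, hC1, hCA⟩ := exists_inverse_adjoint hA hA1
  set H := (evalSp 𝒱 a)ᗮ
  have hderiv : ∀ (X : Λ) t, HasDerivAt (X : ℝ → V) (deriv (X : ℝ → V) t) t :=
    fun X t ↦ jacobi_hasDerivAt (hΛ.1 X X.2) t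
  have hstar : ∀ᶠ t in 𝓝 a, ∀ h ∈ H, ∀ X : Λ, ⟪C t h, (X : ℝ → V) t⟫ = ⟪h, φ.symm X⟫ := by
    filter_upwards [hCA] with t ht h hh X
    obtain ⟨w, hw, hw'⟩ := hfac t X
    rw [← hw, ht.2, hw' h hh]
  have hCd : ∀ᶠ t in 𝓝 a, HasDerivAt C (deriv C t) t :=
    (hC.eventually (by simp)).mono fun t ht ↦
      (ht.differentiableAt (by simp)).hasDerivAt
  have hCdd : HasDerivAt (deriv C) (deriv (deriv C) a) a := by
    have h1 : DifferentiableAt ℝ (fderiv ℝ C) a :=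
      (hC.fderiv_right (m := 1) (by norm_num)).differentiableAt (by simp)
    exact (h1.clm_apply (differentiableAt_const 1)).hasDerivAt
  have hstar' : ∀ᶠ t in 𝓝 a, ∀ h ∈ H, ∀ X : Λ,
      ⟪C t h, deriv (X : ℝ → V) t⟫ + ⟪deriv C t h, (X : ℝ → V) t⟫ = 0 := by
    filter_upwards [hstar.eventually_nhds, hCd] with t ht htd h hh X
    have h1 := (htd.clm_apply (hasDerivAt_const t h)).inner ℝ (hderiv X t)
    simp only [map_zero, add_zero] at h1
    exact h1.unique ((hasDerivAt_const t ⟪h, φ.symm X⟫).congr_of_eventuallyEq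
      (ht.mono fun s hs ↦ hs h hh X))
  have hstar'' : ∀ h ∈ H, ∀ X : Λ,
      ⟪deriv (deriv C) a h, (X : ℝ → V) a⟫ =
        ⟪h, R a ((X : ℝ → V) a)⟫ - 2 * ⟪deriv C a h, deriv (X : ℝ → V) a⟫ := by
    intro h hh X
    have h1 := ((hCd.self_of_nhds.clm_apply (hasDerivAt_const a h)).inner ℝ
      (jacobi_hasDerivAt_deriv (hΛ.1 X X.2) a)).add
      ((hCdd.clm_apply (hasDerivAt_const a h)).inner ℝ (hderiv X a))
    simp only [map_zero, add_zero, hC1] at h1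
    have h2 := h1.unique ((hasDerivAt_const a (0 : ℝ)).congr_of_eventuallyEq
      (hstar'.mono fun s hs ↦ hs h hh X))
    rw [inner_neg_right] at h2
    simp only [one_apply_eq_self] at h2
    linarith
  have hAd : HasDerivAt A (deriv A a) a :=
    (hA.differentiable (by simp) a).hasDerivAt
  have hCA' : ∀ h v, ⟪h, deriv A a v⟫ = -⟪deriv C a h, v⟫ := by
    intro h v
    have h1 := (hCd.self_of_nhds.clm_apply (hasDerivAt_const a h)).inner ℝ
      (hAd.clm_apply (hasDerivAt_const a v))
    simp only [map_zero, add_zero, hC1, hA1, one_apply_eq_self] at h1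
    have h2 := h1.unique ((hasDerivAt_const a ⟪h, v⟫).congr_of_eventuallyEq
      (hCA.mono fun s hs ↦ hs.2 h v))
    linarith
  let P : V →L[ℝ] V := H.starProjection
  have hPH : ∀ v, P v ∈ H := fun v ↦ H.starProjection_apply_mem v
  have hPx : ∀ h ∈ H, ∀ v, ⟪h, v - P v⟫ = 0 := fun h hh v ↦
    Submodule.inner_right_of_mem_orthogonal hh (H.sub_starProjection_mem_orthogonal v)
  let F : ℝ → V →L[ℝ] V := fun t ↦ C t * P + A t * (1 - P)
  have hF1 : F a = 1 := by simp [F, hC1, hA1]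
  have hFd : HasDerivAt F (deriv C a * P + deriv A a * (1 - P)) a :=
    (hCd.self_of_nhds.mul_const P).add (hAd.mul_const (1 - P))
  have hFinv : HasDerivAt (fun t ↦ Ring.inverse (F t))
      (-(deriv C a * P + deriv A a * (1 - P))) a := by
    have h1 := hasFDerivAt_ringInverse (𝕜 := ℝ) (1 : (V →L[ℝ] V)ˣ)
    rw [Units.val_one, ← hF1] at h1
    have h2 := h1.comp_hasDerivAt a hFd
    simp only [inv_one, Units.val_one] at h2
    exact h2.congr_deriv (by simp)
  have hFu : ∀ᶠ t in 𝓝 a, IsUnit (F t) :=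
    hFd.continuousAt (Units.isOpen.mem_nhds (by rw [hF1]; exact isUnit_one))
  have hxH : ∀ i, x i ∈ H := fun i ↦ hspan ▸ Submodule.subset_span ⟨i, rfl⟩
  let g : ℝ → ℝ := fun t ↦ -∑ i, ⟪x i, Ring.inverse (F t) (deriv C t (x i))⟫
  have hg : HasDerivAt g (-∑ i, (⟪x i, deriv (deriv C) a (x i)⟫ -
      ⟪x i, deriv C a (P (deriv C a (x i)))⟫ +
        ⟪deriv C a (x i), deriv C a (x i) - P (deriv C a (x i))⟫)) a := by
    refine (HasDerivAt.fun_sum fun i _ ↦ ?_).neg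
    have h1 := (hasDerivAt_const a (x i)).inner ℝ
      (hFinv.clm_apply (hCdd.clm_apply (hasDerivAt_const a (x i))))
    refine h1.congr_deriv ?_
    simp only [hF1, Ring.inverse_one, map_zero, add_zero, inner_zero_left, neg_apply, add_apply,
      mul_apply_eq_comp, one_apply_eq_self, sub_apply, inner_add_right, inner_neg_right, hCA']
    ring
  have hga : g a = -∑ i, ⟪x i, deriv C a (x i)⟫ := by
    simp [g, hF1]
  refine ⟨g, _, hg, ?_, ?_⟩
  · rw [hga]
    set d : Fin k → V := fun i ↦ deriv C a (x i)
    have hrep : ∀ i, ∃ X : Λ, (X : ℝ → V) a = x i ∧ deriv (X : ℝ → V) a = -d i := by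
      intro i
      obtain ⟨U, hU, hU0, hU1⟩ := hvan (d i + deriv (φ (x i) : ℝ → V) a) fun U hU ↦ by
        have h1 := hstar'.self_of_nhds (x i) (hxH i) ⟨U, hU⟩
        have h2 := hΛ.2.2 _ (φ (x i)).2 U hU a
        rw [hφH _ (hxH i)] at h2
        rw [hC1, one_apply_eq_self] at h1
        rw [inner_add_left, h2, add_comm]
        exact h1
      refine ⟨φ (x i) - ⟨U, hU⟩, ?_, ?_⟩
      · simp [hU0, hφH _ (hxH i)]
      · have := ((hderiv (φ (x i)) a).sub (hderiv ⟨U, hU⟩ a)).deriv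
        simp only [hU1] at this
        exact this.trans (by abel)
    have hsymm : ∀ i, ∀ h ∈ H, ⟪x i, deriv C a h⟫ = ⟪d i, h⟫ := by
      intro i h hh
      obtain ⟨X, hX, hX'⟩ := hrep i
      have h1 := hstar'.self_of_nhds h hh X
      rw [hX, hX', hC1, one_apply_eq_self, inner_neg_right] at h1
      rw [real_inner_comm, real_inner_comm h]
      linarith
    have hsecond : ∀ i, ⟪x i, deriv (deriv C) a (x i)⟫ = ⟪R a (x i), x i⟫ + 2 * ⟪d i, d i⟫ := by
      intro i
      obtain ⟨X, hX, hX'⟩ := hrep i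
      have h1 := hstar'' (x i) (hxH i) X
      rw [hX, hX', inner_neg_right] at h1
      rw [real_inner_comm, h1, real_inner_comm (R a (x i))]
      ring
    have hterm : ∀ i, ⟪R a (x i), x i⟫ + ⟪x i, d i⟫ ^ 2 ≤
        ⟪x i, deriv (deriv C) a (x i)⟫ - ⟪x i, deriv C a (P (d i))⟫ +
          ⟪d i, d i - P (d i)⟫ := by
      intro i
      have h1 : ⟪P (d i), d i⟫ = ⟪P (d i), P (d i)⟫ := by
        have := hPx _ (hPH (d i)) (d i)
        rwa [inner_sub_right, sub_eq_zero] at this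
      have h2 : ⟪x i, d i⟫ = ⟪x i, P (d i)⟫ := by
        have := hPx _ (hxH i) (d i)
        rwa [inner_sub_right, sub_eq_zero] at this
      have h3 : ⟪x i, P (d i)⟫ ^ 2 ≤ ⟪P (d i), P (d i)⟫ := by
        have := real_inner_mul_inner_self_le (x i) (P (d i))
        rw [real_inner_self_eq_norm_sq (x i), hx.1 i] at this
        nlinarith
      have h4 : 0 ≤ ⟪d i - P (d i), d i - P (d i)⟫ := real_inner_self_nonneg
      rw [hsecond, hsymm i _ (hPH _), h2]
      simp only [inner_sub_left, inner_sub_right, real_inner_comm (P (d i)) (d i), h1] at h4 ⊢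
      linarith
    have hsum := Finset.sum_le_sum fun i (_ : i ∈ Finset.univ) ↦ hterm i
    rw [Finset.sum_add_distrib] at hsum
    have hcs := sq_sum_le_card_mul_sum_sq (s := Finset.univ) (f := fun i ↦ ⟪x i, d i⟫)
    rw [Finset.card_univ, Fintype.card_fin] at hcs
    have h5 := mul_le_mul_of_nonneg_left hsum (Nat.cast_nonneg (α := ℝ) k)
    have h6 := mul_le_mul_of_nonneg_left (hRic x hx) (Nat.cast_nonneg (α := ℝ) k)
    rw [neg_sq]
    linarith
  · filter_upwards [hCA, hstar, hstar', hFu] with t htC hts hts' htF y hy hyspan M hM hMt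
    refine sum_inner_eq_frame hx hy (hspan ▸ hPH) (hspan ▸ hPx) htC.2 (fun v ↦ ?_) htF ?_ ?_
    · simp [F]
    · rw [hspan, hyspan]
      intro h hh
      suffices hle : evalSp 𝒱 t ≤ (ℝ ∙ C t h)ᗮ from fun v hv ↦
        (real_inner_comm _ _).trans (Submodule.mem_orthogonal_singleton_iff_inner_right.1 (hle hv))
      refine Submodule.span_le.2 fun v hv ↦ Submodule.mem_orthogonal_singleton_iff_inner_right.2 ?_
      rcases hv with ⟨Y, hY, rfl⟩ | ⟨Y, hY, hY0, rfl⟩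
      · rw [hts h hh ⟨Y, h𝒱Λ hY⟩]
        exact Submodule.inner_left_of_mem_orthogonal ((hφV ⟨Y, h𝒱Λ hY⟩).2 hY) hh
      · rcases eq_or_ne t a with rfl | hta
        · rw [hC1, one_apply_eq_self]
          exact Submodule.inner_left_of_mem_orthogonal
            (Submodule.subset_span (.inr ⟨Y, hY, hY0, rfl⟩)) hh
        · rw [hne t htC.1 hta Y (h𝒱Λ hY) hY0]
          simp [show deriv (0 : ℝ → V) t = 0 from deriv_const t 0]
    · rw [hspan]
      intro i h hh
      have := hts' h hh ⟨M i, hM i⟩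
      rw [← hMt i]
      simp only [real_inner_comm] at this ⊢
      linarith

theorem riccati_comparison {u u' lam : ℝ → ℝ} {κ t₀ tmax : ℝ}
    (hu : ∀ t ∈ Set.Ico t₀ tmax, HasDerivWithinAt u (u' t) (Set.Ico t₀ tmax) t)
    (hu' : ∀ t ∈ Set.Ico t₀ tmax, u' t ≤ -(u t) ^ 2 - κ)
    (hlam : ∀ t ∈ Set.Ico t₀ tmax, HasDerivAt lam (-(lam t ^ 2) - κ) t)
    (h0 : u t₀ ≤ lam t₀) : ∀ t ∈ Set.Ico t₀ tmax, u t ≤ lam t := by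
  intro T hT
  have hsub : Set.Icc t₀ T ⊆ Set.Ico t₀ tmax := fun s hs ↦ ⟨hs.1, hs.2.trans_lt hT.2⟩
  have huc : ContinuousOn u (Set.Icc t₀ T) := fun s hs ↦
    (hu s (hsub hs)).continuousWithinAt.mono hsub
  have hlc : ContinuousOn lam (Set.Icc t₀ T) := fun s hs ↦
    (hlam s (hsub hs)).continuousAt.continuousWithinAt
  obtain ⟨M, hM⟩ := isCompact_Icc.exists_bound_of_continuousOn (huc.add hlc)
  refine le_of_forall_pos_le_add fun ε hε ↦ ?_
  set δ : ℝ := ε * Real.exp (-((M + 1) * (T - t₀)))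
  have hδ : 0 < δ := by positivity
  have hexp : ∀ t, HasDerivAt (fun t ↦ δ * Real.exp ((M + 1) * (t - t₀)))
      (δ * Real.exp ((M + 1) * (t - t₀)) * (M + 1)) t := by
    intro t
    have h1 : HasDerivAt (fun t ↦ (M + 1) * (t - t₀)) (M + 1) t := by
      simpa using ((hasDerivAt_id t).sub_const t₀).const_mul (M + 1)
    simpa [mul_assoc] using h1.exp.const_mul δ
  have hle := image_le_of_deriv_right_lt_deriv_boundary' (f := u) (f' := u')
    (B := fun t ↦ lam t + δ * Real.exp ((M + 1) * (t - t₀)))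
    (B' := fun t ↦ -(lam t ^ 2) - κ + δ * Real.exp ((M + 1) * (t - t₀)) * (M + 1))
    huc
    (fun s hs ↦ (hu s (hsub ⟨hs.1, hs.2.le⟩)).mono_of_mem_nhdsWithin
      (Filter.mem_of_superset (Ico_mem_nhdsGE (hs.2.trans hT.2))
        (Set.Ico_subset_Ico_left hs.1)))
    (by simp; linarith)
    (hlc.add fun s _ ↦ (hexp s).continuousAt.continuousWithinAt)
    (fun s hs ↦ ((hlam s (hsub ⟨hs.1, hs.2.le⟩)).add (hexp s)).hasDerivWithinAt)
    (fun s hs heq ↦ ?_) (Set.right_mem_Icc.2 hT.1)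
  · refine hle.trans_eq ?_
    simp only [δ]
    rw [mul_assoc, ← Real.exp_add]
    simp
  · have h1 := hu' s (hsub ⟨hs.1, hs.2.le⟩)
    have h2 := (abs_le.1 (hM s ⟨hs.1, hs.2.le⟩)).1
    have h3 : 0 < δ * Real.exp ((M + 1) * (s - t₀)) := by positivity
    simp only [Pi.add_apply] at h2
    generalize δ * Real.exp ((M + 1) * (s - t₀)) = E at *
    nlinarith [mul_pos h3 (show 0 < u s + lam s + (M + 1) by linarith)]

theorem finrank_evalSp [FiniteDimensional ℝ V] {R : ℝ → V →L[ℝ] V}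
    (hR : Continuous R) {Λ 𝒱 : Submodule ℝ (ℝ → V)} (hΛ : IsLagrangian R Λ) (h𝒱Λ : 𝒱 ≤ Λ) {a : ℝ}
    (hfull : ∀ X ∈ Λ, X a = 0 → X ∈ 𝒱) :
    Module.finrank ℝ (evalSp 𝒱 a) = Module.finrank ℝ 𝒱 := by
  obtain ⟨-, φ, -, -, -, hφV, -⟩ := exists_adapted_desingularization hR hΛ h𝒱Λ hfull
  have hinj : Function.Injective (Λ.subtype ∘ₗ φ.toLinearMap) :=
    Λ.injective_subtype.comp φ.injective
  have hmap : Submodule.map (Λ.subtype ∘ₗ φ.toLinearMap) (evalSp 𝒱 a) = 𝒱 := by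
    ext X
    constructor
    · rintro ⟨v, hv, rfl⟩
      exact (hφV (φ v)).1 (by simpa using hv)
    · intro hX
      exact ⟨φ.symm ⟨X, h𝒱Λ hX⟩, (hφV ⟨X, h𝒱Λ hX⟩).2 hX, by simp⟩
  rw [(Submodule.equivMapOfInjective _ hinj (evalSp 𝒱 a)).finrank_eq, hmap]

theorem exists_riccati_frame [FiniteDimensional ℝ V] {R : ℝ → V →L[ℝ] V}
    (hR : Continuous R) {Λ 𝒱 : Submodule ℝ (ℝ → V)} (hΛ : IsLagrangian R Λ) (h𝒱Λ : 𝒱 ≤ Λ) {a : ℝ}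
    (hfull : ∀ X ∈ Λ, X a = 0 → X ∈ 𝒱) {k : ℕ}
    (hk : Module.finrank ℝ 𝒱 + k = Module.finrank ℝ V) :
    ∃ (x : Fin k → V) (K : Fin k → ℝ → V), Orthonormal ℝ x ∧
      Submodule.span ℝ (Set.range x) = (evalSp 𝒱 a)ᗮ ∧ (∀ i, K i ∈ Λ) ∧ ∀ i, K i a = x i := by
  obtain ⟨-, φ, -, -, hφH, -⟩ := exists_adapted_desingularization hR hΛ h𝒱Λ hfull
  have hdim : Module.finrank ℝ (evalSp 𝒱 a)ᗮ = k := by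
    have := (evalSp 𝒱 a).finrank_add_finrank_orthogonal
    rw [finrank_evalSp hR hΛ h𝒱Λ hfull] at this
    omega
  let b := (stdOrthonormalBasis ℝ (evalSp 𝒱 a)ᗮ).reindex (finCongr hdim)
  refine ⟨fun i ↦ b i, fun i ↦ φ (b i), b.orthonormal.comp_linearIsometry (evalSp 𝒱 a)ᗮ.subtypeₗᵢ,
    ?_, fun i ↦ (φ _).2, fun i ↦ hφH _ (b i).2⟩
  have h1 := b.toBasis.span_eq
  rw [OrthonormalBasis.coe_toBasis] at h1
  have h2 := congrArg (Submodule.map (evalSp 𝒱 a)ᗮ.subtype) h1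
  rw [Submodule.map_span, ← Set.range_comp, Submodule.map_top, Submodule.range_subtype] at h2
  exact h2

/-- At a time of full index, if `𝒱` consists of the fields of `Λ` orthogonal to `W` at that
time and `W` is contained in the image of `Λ`, then `𝒱(t)ᗮ = W`. -/
theorem orthogonal_evalSp_eq [FiniteDimensional ℝ V] {R : ℝ → V →L[ℝ] V}
    (hR : Continuous R) {Λ 𝒱 : Submodule ℝ (ℝ → V)} (hΛ : IsLagrangian R Λ) {a : ℝ}
    {W : Submodule ℝ V} (hWsub : ∀ x ∈ W, ∃ J ∈ Λ, J a = x)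
    (h𝒱 : ∀ X : ℝ → V, X ∈ 𝒱 ↔ (X ∈ Λ ∧ ∀ w ∈ W, ⟪X a, w⟫ = 0)) :
    (evalSp 𝒱 a)ᗮ = W := by
  have h𝒱Λ : 𝒱 ≤ Λ := fun X hX ↦ ((h𝒱 X).1 hX).1
  have hfull : ∀ X ∈ Λ, X a = 0 → X ∈ 𝒱 := fun X hX h0 ↦
    (h𝒱 X).2 ⟨hX, fun w _ ↦ by rw [h0, inner_zero_left]⟩
  obtain ⟨-, φ, -, -, hφH, -⟩ := exists_adapted_desingularization hR hΛ h𝒱Λ hfull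
  have hW : W ≤ (evalSp 𝒱 a)ᗮ := by
    refine Submodule.le_orthogonal_iff_le_orthogonal.1 (Submodule.span_le.2 ?_)
    rintro _ (⟨X, hX, rfl⟩ | ⟨X, hX, h0, rfl⟩) w hw
    · rw [real_inner_comm]
      exact ((h𝒱 X).1 hX).2 w hw
    · obtain ⟨J, hJ, rfl⟩ := hWsub w hw
      rw [real_inner_comm, hΛ.2.2 X (h𝒱Λ hX) J hJ a, h0, inner_zero_left]
  refine le_antisymm (fun h hh ↦ ?_) hW
  set d := h - W.starProjection h
  have hd : d ∈ (evalSp 𝒱 a)ᗮ := sub_mem hh (hW (W.starProjection_apply_mem h))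
  have hdV : (φ d : ℝ → V) ∈ 𝒱 := (h𝒱 _).2 ⟨(φ d).2, fun w hw ↦ by
    rw [hφH d hd]
    exact Submodule.inner_left_of_mem_orthogonal hw (W.sub_starProjection_mem_orthogonal h)⟩
  have hd0 : ⟪d, d⟫ = 0 := Submodule.inner_right_of_mem_orthogonal
    (Submodule.subset_span (.inl ⟨_, hdV, hφH d hd⟩)) hd
  rw [sub_eq_zero.1 (inner_self_eq_zero.1 hd0)]
  exact W.starProjection_apply_mem h

/-- **Intermediate Ricci comparison (Lemma 8, first part).** Under the radial
bound `Ric_k ≥ k·κ`, if the trace of the Riccati operator of a Lagrangian `Λ`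
restricted to a `k`-dimensional subspace `W ⊆ {J(t₀) : J ∈ Λ}` is at most
`k·λ̃(t₀)`, and `𝒱 = {J ∈ Λ : J(t₀) ⊥ W}` has full index on `[t₀, t_max)`,
then for every `t ∈ [t₀, t_max)` the trace of the Riccati operator on
`H(t) = 𝒱(t)ᗮ` is at most `k·λ̃(t)`. -/
theorem intermediate_ricci_comparison
    [FiniteDimensional ℝ V]
    (k : ℕ) (κ : ℝ)
    (R : ℝ → V →L[ℝ] V)
    (hR_smooth : ContDiff ℝ (⊤ : ℕ∞) R)
    (hR_sym : ∀ t : ℝ, ∀ x y : V, ⟪R t x, y⟫ = ⟪x, R t y⟫)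
    (hRic : ∀ t : ℝ, ∀ e : Fin k → V, Orthonormal ℝ e →
      (k : ℝ) * κ ≤ ∑ i, ⟪R t (e i), e i⟫)
    (Λ : Submodule ℝ (ℝ → V)) (hΛ : IsLagrangian R Λ)
    (t₀ tmax : ℝ) (ht : t₀ < tmax)
    (lam : ℝ → ℝ)
    (hlam : ∀ t ∈ Set.Ico t₀ tmax, HasDerivAt lam (-(lam t ^ 2) - κ) t)
    (W : Submodule ℝ V) (hWdim : Module.finrank ℝ W = k)
    (hWsub : ∀ x ∈ W, ∃ J ∈ Λ, J t₀ = x)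
    (e : Fin k → V) (heW : ∀ i, e i ∈ W) (heON : Orthonormal ℝ e)
    (hespan : Submodule.span ℝ (Set.range e) = W)
    (J : Fin k → (ℝ → V)) (hJΛ : ∀ i, J i ∈ Λ) (hJe : ∀ i, J i t₀ = e i)
    (hinit : ∑ i, ⟪deriv (J i) t₀, e i⟫ ≤ (k : ℝ) * lam t₀)
    (𝒱 : Submodule ℝ (ℝ → V))
    (h𝒱 : ∀ X : ℝ → V, X ∈ 𝒱 ↔ (X ∈ Λ ∧ ∀ w ∈ W, ⟪X t₀, w⟫ = 0))
    (hfull : ∀ t ∈ Set.Ico t₀ tmax, ∀ X ∈ Λ, X t = 0 → X ∈ 𝒱) :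
    ∀ t ∈ Set.Ico t₀ tmax,
      ∀ x : Fin k → V, (∀ i, x i ∈ (evalSp 𝒱 t)ᗮ) → Orthonormal ℝ x →
        Submodule.span ℝ (Set.range x) = (evalSp 𝒱 t)ᗮ →
        ∀ K : Fin k → (ℝ → V), (∀ i, K i ∈ Λ) → (∀ i, K i t = x i) →
          ∑ i, ⟪deriv (K i) t, x i⟫ ≤ (k : ℝ) * lam t := by
  intro t hT x _ hxON hxspan K hKΛ hKx
  rcases Nat.eq_zero_or_pos k with rfl | hk
  · simp
  have hR := hR_smooth.continuous
  have h𝒱Λ : 𝒱 ≤ Λ := fun X hX ↦ ((h𝒱 X).1 hX).1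
  have ht₀ : t₀ ∈ Set.Ico t₀ tmax := Set.left_mem_Ico.2 ht
  have hH₀ : (evalSp 𝒱 t₀)ᗮ = W := orthogonal_evalSp_eq hR hΛ hWsub h𝒱
  have hdim : Module.finrank ℝ 𝒱 + k = Module.finrank ℝ V := by
    rw [← finrank_evalSp hR hΛ h𝒱Λ (hfull t₀ ht₀), ← hWdim, ← hH₀]
    exact (evalSp 𝒱 t₀).finrank_add_finrank_orthogonal
  have hframe := fun s (hs : s ∈ Set.Ico t₀ tmax) ↦
    exists_riccati_frame hR hΛ h𝒱Λ (hfull s hs) hdim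
  choose! y M hyON hyspan hMΛ hMy using hframe
  have hlocal := fun s (hs : s ∈ Set.Ico t₀ tmax) ↦
    exists_local_trace hR hΛ h𝒱Λ (hRic s) (hfull s hs) (hyON s hs) (hyspan s hs)
  choose! g g' hg hg' htr using hlocal
  let σ : ℝ → ℝ := fun s ↦ ∑ i, ⟪deriv (M s i) s, y s i⟫
  have hσg : ∀ s ∈ Set.Ico t₀ tmax, σ s = g s s := fun s hs ↦
    (htr s hs).self_of_nhds _ (hyON s hs) (hyspan s hs) _ (hMΛ s hs) (hMy s hs)
  have hσ : ∀ s ∈ Set.Ico t₀ tmax, HasDerivWithinAt σ (g' s) (Set.Ico t₀ tmax) s := by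
    intro s hs
    refine (hg s hs).hasDerivWithinAt.congr_of_eventuallyEq ?_ (hσg s hs)
    filter_upwards [mem_nhdsWithin_of_mem_nhds (htr s hs), self_mem_nhdsWithin] with r hr hrI
    exact hr _ (hyON r hrI) (hyspan r hrI) _ (hMΛ r hrI) (hMy r hrI)
  have hk' : (0 : ℝ) < k := Nat.cast_pos.2 hk
  have hcomp := riccati_comparison (u := fun s ↦ σ s / k) (u' := fun s ↦ g' s / k) (κ := κ)
    (fun s hs ↦ (hσ s hs).div_const _) (fun s hs ↦ ?_) hlam ?_ t hT
  · rw [div_le_iff₀ hk', hσg t hT] at hcomp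
    rw [(htr t hT).self_of_nhds x hxON hxspan K hKΛ hKx, mul_comm]
    exact hcomp
  · have h1 := hg' s hs
    rw [← hσg s hs] at h1
    rw [div_le_iff₀ hk', ← mul_le_mul_iff_right₀ hk']
    refine h1.trans_eq ?_
    field_simp
  · rw [div_le_iff₀ hk', hσg t₀ ht₀, mul_comm,
      ← (htr t₀ ht₀).self_of_nhds e heON (hespan.trans hH₀.symm) J hJΛ hJe]
    exact hinit
end
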